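/- Let f ∈ C_0(ℝ^d) and F(γ) := e^{⟨f,γ⟩}. Then ∫_Γ (H_0^− F)(γ)² μ(dγ) = ∫_{ℝ^d} z (1 − e^{f(x)})² (∫_Γ exp[(2s−1)E(x,γ) + ⟨2f,γ⟩] μ(dγ)) dx + ∫_{ℝ^d}∫_{ℝ^d} z² e^{f(x_1)}(1 − e^{f(x_1)}) e^{f(x_2)}(1 − e^{f(x_2)}) exp[(2s−1)φ(x_1−x_2)] (∫_Γ exp[(s−1)E(x_1,γ) + (s−1)E(x_2,γ) + ⟨2f,γ⟩] μ(dγ)) dx_1 dx_2. -/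

import Mathlib

open MeasureTheory Set Filter
open scoped ENNReal NNReal BigOperators Topology Classical

noncomputable section

abbrev EucSp (d : ℕ) := EuclideanSpace ℝ (Fin d)

/-- The configuration space `Γ` over `ℝ^d`: locally finite subsets. -/
def Config (d : ℕ) : Type :=
  {γ : Set (EucSp d) // ∀ Λ : Set (EucSp d), IsCompact Λ → (γ ∩ Λ).Finite}

/-- The σ-algebra on `Γ` generated by the maps `γ ↦ |γ ∩ B|`, `B` Borel. -/
instance Config.instMS (d : ℕ) : MeasurableSpace (Config d) :=
  ⨆ (B : Set (EucSp d)) (_ : MeasurableSet B),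
    MeasurableSpace.comap (fun γ : Config d => (γ.1 ∩ B).encard) (⊤ : MeasurableSpace ℕ∞)

/-- `γ ∪ {x}`. -/
def Config.ins {d : ℕ} (γ : Config d) (x : EucSp d) : Config d :=
  ⟨insert x γ.1, fun Λ hΛ => ((γ.2 Λ hΛ).insert x).subset fun y hy => by
    rcases hy with ⟨h1, h2⟩
    rcases h1 with rfl | h1
    · exact Set.mem_insert _ _
    · exact Set.mem_insert_of_mem _ ⟨h1, h2⟩⟩

/-- `γ ∖ {x}`. -/
def Config.del {d : ℕ} (γ : Config d) (x : EucSp d) : Config d :=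
  ⟨γ.1 \ {x}, fun Λ hΛ => (γ.2 Λ hΛ).subset fun y hy => ⟨hy.1.1, hy.2⟩⟩

/-- The pairing `⟨f, γ⟩ = ∑_{x ∈ γ} f x`. -/
def cpair {d : ℕ} (f : EucSp d → ℝ) (γ : Config d) : ℝ := ∑' x : γ.1, f x.1

/-- `exp : [-∞,∞] → [0,∞]`. -/
def eexp (x : EReal) : ℝ≥0∞ :=
  if x = ⊤ then ⊤ else if x = ⊥ then 0 else ENNReal.ofReal (Real.exp x.toReal)

/-- real-valued exponential of an extended real (with `exp(±∞)` sent to junk value `0`). -/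
def rexp (x : EReal) : ℝ := (eexp x).toReal

/-- The relative energy `E(x,γ) = ∑_{y ∈ γ} φ(x-y)` if absolutely convergent, `+∞` otherwise. -/
def energy {d : ℕ} (φ : EucSp d → EReal) (x : EucSp d) (γ : Set (EucSp d)) : EReal :=
  if (∀ y ∈ γ, φ (x - y) ≠ ⊤) ∧ Summable (fun y : γ => (φ (x - y.1)).toReal)
  then (((∑' y : γ, (φ (x - y.1)).toReal) : ℝ) : EReal)
  else ⊤

/-- `∑_{u ∈ γ} φ(u)` if absolutely convergent, `+∞` otherwise. -/
def totPhi {d : ℕ} (φ : EucSp d → EReal) (γ : Set (EucSp d)) : EReal :=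
  if (∀ y ∈ γ, φ y ≠ ⊤) ∧ Summable (fun y : γ => (φ y.1).toReal)
  then (((∑' y : γ, (φ y.1).toReal) : ℝ) : EReal)
  else ⊤

/-- A pair potential: Borel, even, with `φ(x) ∈ ℝ` off the origin. -/
structure IsPairPotential {d : ℕ} (φ : EucSp d → EReal) : Prop where
  meas : Measurable φ
  even : ∀ x : EucSp d, x ≠ 0 → φ (-x) = φ x
  finite_off : ∀ x : EucSp d, x ≠ 0 → φ x ≠ ⊤
  ne_bot : ∀ x, φ x ≠ ⊥

/-- Stability (S): `∑_{{x,y} ⊆ η} φ(x-y) ≥ -B|η|` for all finite `η`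
(stated with the sum over ordered pairs, which doubles both sides). -/
def Stable {d : ℕ} (φ : EucSp d → EReal) (B : ℝ) : Prop :=
  ∀ η : Finset (EucSp d),
    ((-(2 * B * η.card) : ℝ) : EReal) ≤ ∑ p ∈ η.offDiag, φ (p.1 - p.2)

/-- Low activity–high temperature (LA-HT): `∫ |e^{-φ} - 1| z dx < (2 e^{1+2B})⁻¹`. -/
def LAHT {d : ℕ} (φ : EucSp d → EReal) (z B : ℝ) : Prop :=
  ∫⁻ x : EucSp d, ENNReal.ofReal (|rexp (-(φ x)) - 1| * z)
    < ENNReal.ofReal (2 * Real.exp (1 + 2 * B))⁻¹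

/-- The Georgii–Nguyen–Zessin identity characterizing `μ ∈ G(z,φ)`. -/
def GNZ {d : ℕ} (z : ℝ) (φ : EucSp d → EReal) (μ : Measure (Config d)) : Prop :=
  ∀ F : Config d → EucSp d → ℝ≥0∞,
    Measurable (Function.uncurry F) →
    ∫⁻ γ, ∑' x : γ.1, F γ x.1 ∂μ
      = ∫⁻ γ, ∫⁻ x, ENNReal.ofReal z * eexp (-(energy φ x γ.1)) * F (γ.ins x) x ∂volume ∂μ


/-- Ordered `n`-tuples of distinct points of `γ`. -/
def injTuples {d : ℕ} (n : ℕ) (γ : Set (EucSp d)) : Set (Fin n → EucSp d) :=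
  {p | Function.Injective p ∧ ∀ i, p i ∈ γ}

/-- `(k_μ^{(n)})` is the family of correlation functions of `μ`: each `k n` is measurable,
nonnegative and symmetric, and for every measurable symmetric `f : (ℝ^d)^n → [0,∞]`,
`∫_Γ ∑_{{x_1,…,x_n} ⊆ γ} f dμ = (1/n!) ∫ f·kₙ dx` (stated equivalently via the sum over
ordered tuples of distinct points, which absorbs the factor `1/n!`). -/
def HasCorrFns {d : ℕ} (μ : Measure (Config d)) (k : ∀ n : ℕ, (Fin n → EucSp d) → ℝ) : Prop :=
  (∀ n : ℕ, Measurable (k n) ∧ (∀ x, 0 ≤ k n x) ∧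
      ∀ (σ : Equiv.Perm (Fin n)) (x : Fin n → EucSp d), k n (x ∘ σ) = k n x) ∧
  ∀ n : ℕ, 0 < n → ∀ f : (Fin n → EucSp d) → ℝ≥0∞, Measurable f →
    (∀ (σ : Equiv.Perm (Fin n)) (x : Fin n → EucSp d), f (x ∘ σ) = f x) →
    ∫⁻ γ, ∑' p : injTuples n γ.1, f p.1 ∂μ
      = ∫⁻ x : Fin n → EucSp d, f x * ENNReal.ofReal (k n x)

/-- The Ruelle bound `k^{(n)} ≤ ξⁿ`. -/
def RuelleBound {d : ℕ} (k : ∀ n : ℕ, (Fin n → EucSp d) → ℝ) (ξ : ℝ) : Prop :=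
  ∀ n : ℕ, 0 < n → ∀ x : Fin n → EucSp d, k n x ≤ ξ ^ n

/-- Translation invariance of a family of functions on tuples. -/
def TransInvFns {d : ℕ} (k : ∀ n : ℕ, (Fin n → EucSp d) → ℝ) : Prop :=
  ∀ (n : ℕ) (a : EucSp d) (x : Fin n → EucSp d), k n (fun i => x i + a) = k n x

/-- `P` is a partition of `{0,…,n-1}` into nonempty pairwise disjoint blocks. -/
def IsPartOfUniv {n : ℕ} (P : Finset (Finset (Fin n))) : Prop :=
  (∀ b ∈ P, b.Nonempty) ∧ (P : Set (Finset (Fin n))).PairwiseDisjoint id ∧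
    P.sup id = Finset.univ

/-- `u` is the family of Ursell functions of `k`:
`k(η) = ∑ u(η_1) ⋯ u(η_j)`, summing over all partitions of `η`. -/
def IsUrsell {d : ℕ} (k u : ∀ n : ℕ, (Fin n → EucSp d) → ℝ) : Prop :=
  ∀ n : ℕ, 0 < n → ∀ x : Fin n → EucSp d,
    k n x = ∑ P : Finset (Finset (Fin n)),
      if IsPartOfUniv P then ∏ b ∈ P, u b.card (fun i => x (b.orderIsoOfFin rfl i).1) else 0

/-- `f ∈ C_0(ℝ^d)`: continuous with compact support. -/
def IsC0 {d : ℕ} (f : EucSp d → ℝ) : Prop := Continuous f ∧ HasCompactSupport f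

/-- Cylinder functions `FC_b(C_0(ℝ^d),Γ)`. -/
def Cyl {d : ℕ} (F : Config d → ℝ) : Prop :=
  ∃ (N : ℕ) (f : Fin N → EucSp d → ℝ) (g : (Fin N → ℝ) → ℝ),
    (∀ i, IsC0 (f i)) ∧ Continuous g ∧ (∃ C, ∀ y, |g y| ≤ C) ∧
    ∀ γ, F γ = g fun i => cpair (f i) γ

/-- `(D_x^- F)(γ) = F(γ∖x) - F(γ)`. -/
def Dminus {d : ℕ} (F : Config d → ℝ) (x : EucSp d) (γ : Config d) : ℝ := F (γ.del x) - F γ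

/-- `(D_x^+ F)(γ) = F(γ∪x) - F(γ)`. -/
def Dplus {d : ℕ} (F : Config d → ℝ) (x : EucSp d) (γ : Config d) : ℝ := F (γ.ins x) - F γ

/-- `(D_{xy}^{-+} F)(γ) = F(γ∖x∪y) - F(γ)`. -/
def Dpm {d : ℕ} (F : Config d → ℝ) (x y : EucSp d) (γ : Config d) : ℝ :=
  F ((γ.del x).ins y) - F γ

/-- The Glauber bilinear form `E_G`. -/
def glauberForm {d : ℕ} (s : ℝ) (φ : EucSp d → EReal) (μ : Measure (Config d))
    (F G : Config d → ℝ) : ℝ :=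
  ∫ γ, (∑' x : γ.1,
      rexp ((s : EReal) * energy φ x.1 (γ.1 \ {x.1})) * Dminus F x.1 γ * Dminus G x.1 γ) ∂μ

/-- The Kawasaki bilinear form `E_K`. -/
def kawasakiForm {d : ℕ} (s : ℝ) (a : EucSp d → ℝ) (φ : EucSp d → EReal)
    (μ : Measure (Config d)) (F G : Config d → ℝ) : ℝ :=
  (1 / 2) * ∫ γ, (∑' x : γ.1, ∫ y : EucSp d,
      a (x.1 - y) *
        rexp ((s : EReal) * energy φ x.1 (γ.1 \ {x.1}) +
          ((s - 1 : ℝ) : EReal) * energy φ y (γ.1 \ {x.1})) *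
        Dpm F x.1 y γ * Dpm G x.1 y γ) ∂μ

/-- The Glauber generator `H_G`. -/
def HG {d : ℕ} (s z : ℝ) (φ : EucSp d → EReal) (F : Config d → ℝ) (γ : Config d) : ℝ :=
  -(∑' x : γ.1, rexp ((s : EReal) * energy φ x.1 (γ.1 \ {x.1})) * Dminus F x.1 γ)
    - ∫ x : EucSp d, z * rexp (((s - 1 : ℝ) : EReal) * energy φ x γ.1) * Dplus F x γ

/-- The Kawasaki generator `H_K`. -/
def HK {d : ℕ} (s : ℝ) (a : EucSp d → ℝ) (φ : EucSp d → EReal) (F : Config d → ℝ)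
    (γ : Config d) : ℝ :=
  -(∑' x : γ.1, ∫ y : EucSp d,
      a (x.1 - y) * rexp ((s : EReal) * energy φ x.1 (γ.1 \ {x.1}) +
        ((s - 1 : ℝ) : EReal) * energy φ y (γ.1 \ {x.1})) * Dpm F x.1 y γ)

/-- The scaled jump kernel `a_ε(x) = ε^d a(ε x)`. -/
def aScaled {d : ℕ} (a : EucSp d → ℝ) (ε : ℝ) (x : EucSp d) : ℝ := ε ^ d * a (ε • x)

/-- `H_ε^-` (death part of the Kawasaki generator with kernel `aa`). -/
def HepsMinus {d : ℕ} (s : ℝ) (aa : EucSp d → ℝ) (φ : EucSp d → EReal)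
    (F : Config d → ℝ) (γ : Config d) : ℝ :=
  -(∑' x : γ.1, Dminus F x.1 γ * ∫ y : EucSp d,
      aa (x.1 - y) * rexp ((s : EReal) * energy φ x.1 (γ.1 \ {x.1}) +
        ((s - 1 : ℝ) : EReal) * energy φ y (γ.1 \ {x.1})))

/-- `H_ε^+` (birth part of the Kawasaki generator with kernel `aa`). -/
def HepsPlus {d : ℕ} (s : ℝ) (aa : EucSp d → ℝ) (φ : EucSp d → EReal)
    (F : Config d → ℝ) (γ : Config d) : ℝ :=
  -(∑' x : γ.1, ∫ y : EucSp d,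
      aa (x.1 - y) * rexp ((s : EReal) * energy φ x.1 (γ.1 \ {x.1}) +
        ((s - 1 : ℝ) : EReal) * energy φ y (γ.1 \ {x.1})) * Dplus F y (γ.del x.1))

/-- `H_0^-` (death part of the Glauber generator). -/
def H0Minus {d : ℕ} (s : ℝ) (φ : EucSp d → EReal) (F : Config d → ℝ) (γ : Config d) : ℝ :=
  -(∑' x : γ.1, rexp ((s : EReal) * energy φ x.1 (γ.1 \ {x.1})) * Dminus F x.1 γ)

/-- `H_0^+` (birth part of the Glauber generator). -/
def H0Plus {d : ℕ} (s z : ℝ) (φ : EucSp d → EReal) (F : Config d → ℝ) (γ : Config d) : ℝ :=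
  -∫ x : EucSp d, z * rexp (((s - 1 : ℝ) : EReal) * energy φ x γ.1) * Dplus F x γ

/-- The standing assumptions of the paper: `s ∈ [0,1/2]`, a stable pair potential in the
low activity–high temperature regime, bounded outside a ball, and `μ` the Gibbs measure
from Ruelle's theorem with its correlation and Ursell functions. -/
structure Setting (d : ℕ) (s z B ξ : ℝ) (φ : EucSp d → EReal) (μ : Measure (Config d))
    (k u : ∀ n : ℕ, (Fin n → EucSp d) → ℝ) : Prop where
  hd : 0 < d
  hs0 : 0 ≤ s
  hs1 : s ≤ 1 / 2
  pp : IsPairPotential φ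
  hB : 0 ≤ B
  stable : Stable φ B
  hz : 0 < z
  laht : LAHT φ z B
  bddOutside : ∃ R C : ℝ, ∀ x : EucSp d, R ≤ ‖x‖ → ∃ r : ℝ, φ x = (r : EReal) ∧ |r| ≤ C
  prob : IsProbabilityMeasure μ
  gnz : GNZ z φ μ
  corr : HasCorrFns μ k
  ti : TransInvFns k
  hξ : 0 < ξ
  ruelle : RuelleBound k ξ
  ursell : IsUrsell k u
  ursellInt : ∀ m : ℕ,
    Integrable (fun y : Fin (m + 1) → EucSp d => u (m + 2) (Fin.cons 0 y)) volume

/-- The jump kernel `a`: bounded, nonnegative, even, integrable. -/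
structure GoodA {d : ℕ} (a : EucSp d → ℝ) : Prop where
  meas : Measurable a
  nonneg : ∀ x, 0 ≤ a x
  bdd : ∃ C, ∀ x, a x ≤ C
  even : ∀ x, a (-x) = a x
  int : Integrable a volume

/-- `φ(x) → 0` as `|x| → ∞`. -/
def PhiVanishes {d : ℕ} (φ : EucSp d → EReal) : Prop :=
  Tendsto φ (cocompact (EucSp d)) (nhds (0 : EReal))

/-- The normalization `∫ a dx = (∫_Γ exp[(s-1) ∑_{u∈γ} φ(u)] dμ(γ))⁻¹`. -/
def NormalizedA {d : ℕ} (s : ℝ) (a : EucSp d → ℝ) (φ : EucSp d → EReal)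
    (μ : Measure (Config d)) : Prop :=
  (∫ x : EucSp d, a x) = (∫ γ, rexp (((s - 1 : ℝ) : EReal) * totPhi φ γ.1) ∂μ)⁻¹

section

open ProbabilityTheory

/-- The counting measure carried by a configuration. -/
def Config.cnt {d : ℕ} (γ : Config d) : Measure (EucSp d) :=
  Measure.sum fun x : γ.1 => Measure.dirac x.1

theorem Config.countable {d : ℕ} (γ : Config d) : γ.1.Countable := by
  have h : γ.1 = ⋃ n : ℕ, γ.1 ∩ Metric.closedBall 0 n := by
    rw [← Set.inter_iUnion, Metric.iUnion_closedBall_nat, Set.inter_univ]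
  rw [h]
  exact Set.countable_iUnion fun n => (γ.2 _ (isCompact_closedBall _ _)).countable

instance Config.instCountable {d : ℕ} (γ : Config d) : Countable γ.1 :=
  γ.countable.to_subtype

theorem Config.lintegral_cnt {d : ℕ} (γ : Config d) (g : EucSp d → ℝ≥0∞) :
    ∫⁻ x, g x ∂γ.cnt = ∑' x : γ.1, g x.1 := by
  simp [Config.cnt, lintegral_sum_measure]

theorem Config.cnt_apply {d : ℕ} (γ : Config d) {B : Set (EucSp d)} (hB : MeasurableSet B) :
    γ.cnt B = ((γ.1 ∩ B).encard : ℝ≥0∞) := by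
  have h := γ.lintegral_cnt (B.indicator 1)
  rw [lintegral_indicator_one hB] at h
  rw [h, ← ENNReal.tsum_set_one, tsum_subtype (γ.1 ∩ B) (fun _ => (1 : ℝ≥0∞)),
    tsum_subtype γ.1 (B.indicator 1), ← Set.indicator_indicator]
  rfl

theorem Config.measurable_cnt {d : ℕ} : Measurable (Config.cnt (d := d)) := by
  refine Measure.measurable_of_measurable_coe _ fun B hB => ?_
  simp only [Config.cnt_apply _ hB]
  have h1 : @Measurable (Config d) ℕ∞ _ ⊤ fun γ => (γ.1 ∩ B).encard := by
    refine Measurable.mono (comap_measurable (m := (⊤ : MeasurableSpace ℕ∞))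
      (fun γ : Config d => (γ.1 ∩ B).encard)) ?_ le_rfl
    exact le_iSup₂_of_le B hB le_rfl
  exact (measurable_from_top (f := ENat.toENNReal)).comp h1

theorem Config.measurable_of_cnt {d : ℕ} {Ω : Type*} [MeasurableSpace Ω] {T : Ω → Config d}
    (h : ∀ B, MeasurableSet B → Measurable fun ω => (T ω).cnt B) : Measurable T := by
  refine Measurable.of_comap_le ?_
  simp only [Config.instMS, MeasurableSpace.comap_iSup, MeasurableSpace.comap_comp]
  refine iSup₂_le fun B hB => ?_
  rw [← measurable_iff_comap_le]
  have h1 := h B hB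
  simp only [Config.cnt_apply _ hB] at h1
  refine @measurable_to_countable' ℕ∞ Ω ⊤ _ _ _ fun n => ?_
  have : (fun γ : Config d => (γ.1 ∩ B).encard) ∘ T ⁻¹' {n}
      = (fun ω => (((T ω).1 ∩ B).encard : ℝ≥0∞)) ⁻¹' {(n : ℝ≥0∞)} := by
    ext ω; simp
  rw [this]
  exact h1 (measurableSet_singleton _)

/-- The counting measures of configurations as a kernel. -/
def cntKernel (d : ℕ) : Kernel (Config d) (EucSp d) := ⟨Config.cnt, Config.measurable_cnt⟩

@[simp] theorem cntKernel_apply {d : ℕ} (γ : Config d) : cntKernel d γ = γ.cnt := rfl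

theorem Config.cnt_lt_top {d : ℕ} (γ : Config d) {B : Set (EucSp d)} (hB : MeasurableSet B)
    (hb : Bornology.IsBounded B) : γ.cnt B < ∞ := by
  rw [Config.cnt_apply _ hB]
  have : (γ.1 ∩ B).Finite :=
    (γ.2 _ hb.isCompact_closure).subset (Set.inter_subset_inter_right _ subset_closure)
  simpa [lt_top_iff_ne_top] using this

instance cntKernel_sFinite (d : ℕ) : IsSFiniteKernel (cntKernel d) := by
  let N : EucSp d → ℕ := fun x => ⌊‖x‖⌋₊
  have hN : Measurable N := Nat.measurable_floor.comp measurable_norm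
  have hS : ∀ n, MeasurableSet (N ⁻¹' {n}) := fun n => hN (measurableSet_singleton n)
  have hSb : ∀ n, Bornology.IsBounded (N ⁻¹' {n}) := fun n => by
    refine (Metric.isBounded_closedBall (x := (0 : EucSp d)) (r := n + 1)).subset fun x hx => ?_
    have : ⌊‖x‖⌋₊ = n := hx
    simpa [← this] using (Nat.lt_floor_add_one ‖x‖).le
  have hA : ∀ n m : ℕ, MeasurableSet {γ : Config d | γ.cnt (N ⁻¹' {n}) = m} := fun n m =>
    ((Measure.measurable_coe (hS n)).comp Config.measurable_cnt) (measurableSet_singleton _)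
  let K : ℕ → ℕ → Kernel (Config d) (EucSp d) := fun n m =>
    Kernel.piecewise (hA n m) ((cntKernel d).restrict (hS n)) 0
  have hK : ∀ n m, IsSFiniteKernel (K n m) := fun n m => by
    have : IsFiniteKernel (K n m) := by
      refine ⟨m, ENNReal.natCast_lt_top m, fun γ => ?_⟩
      simp only [K, Kernel.piecewise_apply]
      split_ifs with h
      · simp only [Kernel.restrict_apply, cntKernel_apply, Measure.restrict_apply_univ]
        exact le_of_eq h
      · simp
    infer_instance
  have : cntKernel d = Kernel.sum fun n => Kernel.sum fun m => K n m := by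
    ext γ B hB
    simp only [Kernel.sum_apply, Measure.sum_apply _ hB, cntKernel_apply]
    have h1 : ∀ n, ∑' m, K n m γ B = γ.cnt (B ∩ N ⁻¹' {n}) := fun n => by
      obtain ⟨m, hm⟩ : ∃ m : ℕ, γ.cnt (N ⁻¹' {n}) = m := by
        have h2 := Config.cnt_lt_top γ (hS n) (hSb n)
        rw [Config.cnt_apply _ (hS n)] at h2 ⊢
        obtain ⟨m, hm⟩ := ENat.ne_top_iff_exists.1
          (fun h => by simp [h] at h2 : (γ.1 ∩ N ⁻¹' {n}).encard ≠ ⊤)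
        exact ⟨m, by rw [← hm]; simp⟩
      rw [tsum_eq_single m]
      · simp [K, Kernel.piecewise_apply, hm, Kernel.restrict_apply, Measure.restrict_apply hB]
      · intro m' hm'
        have : (m : ℝ≥0∞) ≠ m' := by simpa using hm'.symm
        simp [K, Kernel.piecewise_apply, hm, this]
    simp only [h1]
    rw [← measure_iUnion]
    · congr 1; ext x; simp
    · intro i j hij
      refine Set.disjoint_left.2 fun x hx hx' => hij ?_
      rw [← hx.2, ← hx'.2]
    · exact fun n => hB.inter (hS n)
  rw [this]
  exact Kernel.isSFiniteKernel_sum (hκs := fun n => Kernel.isSFiniteKernel_sum (hκs := hK n))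

instance Config.cnt_sFinite {d : ℕ} (γ : Config d) : SFinite γ.cnt :=
  inferInstanceAs (SFinite (cntKernel d γ))

theorem measurable_lintegral_cnt {d : ℕ} {Ω : Type*} [MeasurableSpace Ω] {T : Ω → Config d}
    (hT : Measurable T) {g : Ω → EucSp d → ℝ≥0∞} (hg : Measurable (Function.uncurry g)) :
    Measurable fun ω => ∫⁻ x, g ω x ∂(T ω).cnt :=
  Measurable.lintegral_kernel_prod_right (κ := (cntKernel d).comap T hT) hg

theorem measurable_integral_cnt {d : ℕ} {Ω : Type*} [MeasurableSpace Ω] {T : Ω → Config d}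
    (hT : Measurable T) {g : Ω → EucSp d → ℝ} (hg : Measurable (Function.uncurry g)) :
    Measurable fun ω => ∫ x, g ω x ∂(T ω).cnt :=
  (StronglyMeasurable.integral_kernel_prod_right (κ := (cntKernel d).comap T hT)
    hg.stronglyMeasurable).measurable

theorem Config.cnt_eq {d : ℕ} (γ : Config d) {B : Set (EucSp d)} (hB : MeasurableSet B) :
    γ.cnt B = ∫⁻ x, B.indicator 1 x ∂γ.cnt := (lintegral_indicator_one hB).symm

theorem Config.lintegral_cnt_ins {d : ℕ} (γ : Config d) (x : EucSp d) (hx : x ∉ γ.1)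
    (g : EucSp d → ℝ≥0∞) :
    ∫⁻ y, g y ∂(γ.ins x).cnt = g x + ∫⁻ y, g y ∂γ.cnt := by
  have hi : ∀ y, y ∈ (γ.ins x).1 ↔ y = x ∨ y ∈ γ.1 := fun _ => Iff.rfl
  rw [Config.lintegral_cnt, Config.lintegral_cnt, tsum_subtype (γ.ins x).1 g,
    tsum_subtype γ.1 g, ENNReal.tsum_eq_add_tsum_ite x]
  congr 1
  · simp [hi]
  · congr 1
    ext y
    by_cases h : y = x
    · subst h; simp [hx]
    · simp [h, Set.indicator_apply, hi]

theorem Config.lintegral_cnt_del {d : ℕ} (γ : Config d) (x : EucSp d)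
    (g : EucSp d → ℝ≥0∞) :
    ∫⁻ y, g y ∂(γ.del x).cnt = ∫⁻ y, (if y = x then 0 else g y) ∂γ.cnt := by
  have hi : ∀ y, y ∈ (γ.del x).1 ↔ y ∈ γ.1 ∧ y ≠ x := fun _ => Iff.rfl
  rw [Config.lintegral_cnt, Config.lintegral_cnt, tsum_subtype (γ.del x).1 g,
    tsum_subtype γ.1 fun y => if y = x then 0 else g y]
  congr 1
  ext y
  by_cases h : y = x <;> simp [h, Set.indicator_apply, hi]

theorem Config.del_ins {d : ℕ} (γ : Config d) {x : EucSp d} (hx : x ∉ γ.1) :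
    (γ.ins x).del x = γ := by
  apply Subtype.ext
  simp [Config.ins, Config.del, hx]

theorem Config.ins_del {d : ℕ} (γ : Config d) {x : EucSp d} (hx : x ∈ γ.1) :
    (γ.del x).ins x = γ := by
  apply Subtype.ext
  simp [Config.ins, Config.del, Set.insert_eq_of_mem hx]

theorem Config.ins_mem {d : ℕ} (γ : Config d) {x : EucSp d} (hx : x ∈ γ.1) :
    γ.ins x = γ := Subtype.ext (Set.insert_eq_of_mem hx)

theorem Config.measurable_del {d : ℕ} :
    Measurable fun p : EucSp d × Config d => p.2.del p.1 := by
  refine Config.measurable_of_cnt fun B hB => ?_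
  simp only [Config.cnt_eq _ hB, Config.lintegral_cnt_del]
  refine measurable_lintegral_cnt measurable_snd ?_
  refine Measurable.ite ?_ measurable_const ?_
  · exact measurableSet_eq_fun measurable_snd (measurable_fst.comp measurable_fst)
  · exact (measurable_one.indicator hB).comp measurable_snd

theorem Config.measurableSet_mem {d : ℕ} :
    MeasurableSet {p : EucSp d × Config d | p.1 ∈ p.2.1} := by
  have : {p : EucSp d × Config d | p.1 ∈ p.2.1}
      = {p | ∫⁻ y, (if y = p.1 then 1 else 0) ∂p.2.cnt = 0}ᶜ := by
    ext p
    simp only [Config.lintegral_cnt, Set.mem_compl_iff, Set.mem_ofPred_eq, ENNReal.tsum_eq_zero]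
    simp
  rw [this]
  refine MeasurableSet.compl (measurable_lintegral_cnt measurable_snd ?_
    (measurableSet_singleton 0))
  exact Measurable.ite (measurableSet_eq_fun measurable_snd (measurable_fst.comp measurable_fst))
    measurable_const measurable_const

theorem Config.measurable_ins {d : ℕ} :
    Measurable fun p : EucSp d × Config d => p.2.ins p.1 := by
  refine Config.measurable_of_cnt fun B hB => ?_
  have : (fun p : EucSp d × Config d => (p.2.ins p.1).cnt B) = fun p =>
      if p.1 ∈ p.2.1 then p.2.cnt B else B.indicator 1 p.1 + p.2.cnt B := by
    ext p
    split_ifs with h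
    · rw [Config.ins_mem _ h]
    · rw [Config.cnt_eq _ hB, Config.lintegral_cnt_ins _ _ h, ← Config.cnt_eq _ hB]
  rw [this]
  have h2 : Measurable fun p : EucSp d × Config d => p.2.cnt B :=
    ((Measure.measurable_coe hB).comp Config.measurable_cnt).comp measurable_snd
  exact Measurable.ite Config.measurableSet_mem h2
    (((measurable_one.indicator hB).comp measurable_fst).add h2)

theorem eexp_coe (r : ℝ) : eexp (r : EReal) = ENNReal.ofReal (Real.exp r) := by
  simp [eexp]

theorem rexp_coe (r : ℝ) : rexp (r : EReal) = Real.exp r := by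
  simp [rexp, eexp_coe, (Real.exp_pos r).le]

theorem rexp_nonneg (e : EReal) : 0 ≤ rexp e := ENNReal.toReal_nonneg

theorem measurable_eexp : Measurable eexp :=
  EReal.measurable_of_measurable_real (by
    simp only [eexp_coe]
    exact Real.measurable_exp.ennreal_ofReal)

theorem measurable_rexp : Measurable rexp := measurable_eexp.ennreal_toReal

theorem Config.integral_cnt {d : ℕ} (γ : Config d) (g : EucSp d → ℝ) :
    ∫ x, g x ∂γ.cnt = ∑' x : γ.1, g x.1 := by
  have := integral_sum_dirac (f := g) (x := fun x : γ.1 => x.1) (c := fun _ => 1) (by simp)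
  simpa [Config.cnt] using this

theorem Config.summable_iff {d : ℕ} (γ : Config d) (g : EucSp d → ℝ) :
    Summable (fun y : γ.1 => g y.1) ↔ ∫⁻ y, ‖g y‖ₑ ∂γ.cnt < ∞ := by
  rw [Config.lintegral_cnt, ← summable_abs_iff]
  have : ∀ y : γ.1, ‖g y.1‖ₑ = ENNReal.ofReal |g y.1| := fun y => Real.enorm_eq_ofReal_abs _
  simp only [this, lt_top_iff_ne_top]
  refine ⟨fun h => h.tsum_ofReal_ne_top, fun h => ?_⟩
  have := ENNReal.summable_toReal h
  simpa using this

theorem measurableSet_summable {d : ℕ} {φ : EucSp d → EReal} (hφ : Measurable φ) :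
    MeasurableSet {p : EucSp d × Config d | Summable fun y : p.2.1 => (φ (p.1 - y.1)).toReal} := by
  have : {p : EucSp d × Config d | Summable fun y : p.2.1 => (φ (p.1 - y.1)).toReal}
      = {p | ∫⁻ y, ‖(φ (p.1 - y)).toReal‖ₑ ∂p.2.cnt < ∞} := by
    ext p
    exact Config.summable_iff p.2 fun y => (φ (p.1 - y)).toReal
  rw [this]
  refine measurable_lintegral_cnt measurable_snd ?_ measurableSet_Iio
  exact (hφ.comp ((measurable_fst.comp measurable_fst).sub measurable_snd)).ereal_toReal.enorm

theorem measurable_energy {d : ℕ} {φ : EucSp d → EReal} (hφ : Measurable φ) :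
    Measurable fun p : EucSp d × Config d => energy φ p.1 p.2.1 := by
  have hsub : Measurable fun q : (EucSp d × Config d) × EucSp d => φ (q.1.1 - q.2) :=
    hφ.comp ((measurable_fst.comp measurable_fst).sub measurable_snd)
  have h1 : MeasurableSet {p : EucSp d × Config d | ∀ y ∈ p.2.1, φ (p.1 - y) ≠ ⊤} := by
    have : {p : EucSp d × Config d | ∀ y ∈ p.2.1, φ (p.1 - y) ≠ ⊤}
        = {p | ∫⁻ y, (if φ (p.1 - y) = ⊤ then 1 else 0) ∂p.2.cnt = 0} := by
      ext p
      simp only [Config.lintegral_cnt, Set.mem_ofPred_eq, ENNReal.tsum_eq_zero]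
      simp
    rw [this]
    refine measurable_lintegral_cnt measurable_snd ?_ (measurableSet_singleton 0)
    exact Measurable.ite (hsub (measurableSet_singleton ⊤)) measurable_const measurable_const
  have h2 := measurableSet_summable hφ
  unfold energy
  refine Measurable.ite (h1.inter h2) (Measurable.coe_real_ereal ?_) measurable_const
  have : (fun p : EucSp d × Config d => ∑' y : p.2.1, (φ (p.1 - y.1)).toReal)
      = fun p => ∫ y, (φ (p.1 - y)).toReal ∂p.2.cnt := by
    ext p
    exact (Config.integral_cnt p.2 fun y => (φ (p.1 - y)).toReal).symm
  rw [this]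
  exact measurable_integral_cnt measurable_snd hsub.ereal_toReal

theorem measurable_cpair {d : ℕ} {f : EucSp d → ℝ} (hf : Measurable f) :
    Measurable fun γ : Config d => cpair f γ := by
  have : (fun γ : Config d => cpair f γ) = fun γ => ∫ x, f x ∂γ.cnt := by
    ext γ; exact (Config.integral_cnt γ f).symm
  rw [this]
  exact measurable_integral_cnt measurable_id (hf.comp measurable_snd)

/-- `γ` has no point at `x` and the relative energy of `x` and `γ` converges absolutely. -/
def Tempered {d : ℕ} (φ : EucSp d → EReal) (x : EucSp d) (γ : Config d) : Prop :=
  x ∉ γ.1 ∧ Summable fun y : γ.1 => (φ (x - y.1)).toReal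

/-- The real-valued relative energy. -/
def realEnergy {d : ℕ} (φ : EucSp d → EReal) (x : EucSp d) (γ : Config d) : ℝ :=
  ∑' y : γ.1, (φ (x - y.1)).toReal

theorem measurableSet_tempered {d : ℕ} {φ : EucSp d → EReal} (hφ : Measurable φ) :
    MeasurableSet {p : EucSp d × Config d | Tempered φ p.1 p.2} := by
  exact Config.measurableSet_mem.compl.inter (measurableSet_summable hφ)

theorem Tempered.energy_eq {d : ℕ} {φ : EucSp d → EReal} (hφ : IsPairPotential φ)
    {x : EucSp d} {γ : Config d} (h : Tempered φ x γ) :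
    energy φ x γ.1 = (realEnergy φ x γ : ℝ) := by
  rw [energy, if_pos ⟨fun y hy => hφ.finite_off _ fun h0 =>
    h.1 (sub_eq_zero.1 h0 ▸ hy), h.2⟩]
  rfl

/-- Adding a point to the index set of a real series over a configuration. -/
theorem Config.hasSum_ins {d : ℕ} (γ : Config d) {x : EucSp d} (hx : x ∉ γ.1) {g : EucSp d → ℝ}
    (hg : Summable fun y : γ.1 => g y.1) :
    HasSum (fun y : (γ.ins x).1 => g y.1) (g x + ∑' y : γ.1, g y.1) := by
  have h1 : HasSum (g ∘ ((↑) : ({x} : Set (EucSp d)) → EucSp d)) (g x) := by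
    have := hasSum_unique (g ∘ ((↑) : ({x} : Set (EucSp d)) → EucSp d))
    simpa using this
  have h2 : HasSum (g ∘ ((↑) : γ.1 → EucSp d)) (∑' y : γ.1, g y.1) := hg.hasSum
  exact h1.add_disjoint (Set.disjoint_singleton_left.2 hx) h2

theorem Tempered.ins {d : ℕ} {φ : EucSp d → EReal}
    {x y : EucSp d} {γ : Config d} (h : Tempered φ x γ) (hxy : x ≠ y) (hy : y ∉ γ.1) :
    Tempered φ x (γ.ins y) ∧
      realEnergy φ x (γ.ins y) = realEnergy φ x γ + (φ (x - y)).toReal := by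
  have := γ.hasSum_ins hy h.2 (g := fun y => (φ (x - y)).toReal)
  refine ⟨⟨fun hx => ?_, this.summable⟩, ?_⟩
  · rcases hx with hx | hx
    · exact hxy hx
    · exact h.1 hx
  · rw [realEnergy, this.tsum_eq, add_comm]; rfl

theorem Config.summable_of_isC0 {d : ℕ} (γ : Config d) {f : EucSp d → ℝ}
    (hf : HasCompactSupport f) : Summable fun y : γ.1 => f y.1 := by
  refine summable_of_hasFiniteSupport ?_
  have := γ.2 _ hf
  refine ((this.preimage (f := ((↑) : γ.1 → EucSp d)) Subtype.val_injective.injOn)).subset ?_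
  intro y hy
  exact ⟨y.2, subset_tsupport _ hy⟩

theorem cpair_ins {d : ℕ} {f : EucSp d → ℝ} (hf : HasCompactSupport f) {γ : Config d}
    {x : EucSp d} (hx : x ∉ γ.1) : cpair f (γ.ins x) = f x + cpair f γ :=
  (γ.hasSum_ins hx (γ.summable_of_isC0 hf)).tsum_eq

/-- The Gibbsian weight `z e^{-E(x,γ)}`. -/
def gibbsWeight {d : ℕ} (z : ℝ) (φ : EucSp d → EReal) (p : EucSp d × Config d) : ℝ≥0∞ :=
  ENNReal.ofReal z * eexp (-(energy φ p.1 p.2.1))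

/-- The product weight `z² e^{-E(y,γ)} e^{-E(x,γ ∪ y)}`. -/
def gibbsWeight₂ {d : ℕ} (z : ℝ) (φ : EucSp d → EReal)
    (q : (EucSp d × EucSp d) × Config d) : ℝ≥0∞ :=
  gibbsWeight z φ (q.1.2, q.2) * gibbsWeight z φ (q.1.1, q.2.ins q.1.2)

theorem measurable_gibbsWeight {d : ℕ} {z : ℝ} {φ : EucSp d → EReal} (hφ : Measurable φ) :
    Measurable (gibbsWeight (d := d) z φ) :=
  (measurable_eexp.comp (measurable_energy hφ).neg).const_mul _

theorem measurable_gibbsWeight₂ {d : ℕ} {z : ℝ} {φ : EucSp d → EReal} (hφ : Measurable φ) :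
    Measurable (gibbsWeight₂ (d := d) z φ) := by
  have h2 : Measurable fun q : (EucSp d × EucSp d) × Config d => (q.1.2, q.2) :=
    (measurable_snd.comp measurable_fst).prodMk measurable_snd
  exact ((measurable_gibbsWeight hφ).comp h2).mul ((measurable_gibbsWeight hφ).comp
    ((measurable_fst.comp measurable_fst).prodMk (Config.measurable_ins.comp h2)))

theorem GNZ.lintegral_point {d : ℕ} {z : ℝ} {φ : EucSp d → EReal} {μ : Measure (Config d)}
    [SFinite μ] (h : GNZ z φ μ) (hφ : Measurable φ) {F : EucSp d × Config d → ℝ≥0∞}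
    (hF : Measurable F) :
    ∫⁻ γ, ∫⁻ x, F (x, γ) ∂γ.cnt ∂μ
      = ∫⁻ p, gibbsWeight z φ p * F (p.1, p.2.ins p.1) ∂(volume.prod μ) := by
  simp only [Config.lintegral_cnt]
  rw [h (fun γ x => F (x, γ)) (hF.comp measurable_swap), lintegral_prod_symm]
  · rfl
  · exact ((measurable_gibbsWeight hφ).mul
      (hF.comp (measurable_fst.prodMk Config.measurable_ins))).aemeasurable

theorem Config.lintegral_cnt_eq_add_del {d : ℕ} (γ : Config d) {x : EucSp d} (hx : x ∈ γ.1)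
    (g : EucSp d → ℝ≥0∞) : ∫⁻ y, g y ∂γ.cnt = g x + ∫⁻ y, g y ∂(γ.del x).cnt := by
  conv_lhs => rw [← γ.ins_del hx]
  exact Config.lintegral_cnt_ins (γ.del x) x (fun h => h.2 rfl) g

theorem GNZ.lintegral_pair {d : ℕ} {z : ℝ} {φ : EucSp d → EReal} {μ : Measure (Config d)}
    [SFinite μ] (h : GNZ z φ μ) (hφ : Measurable φ) (hns : ∀ x : EucSp d, ∀ᵐ γ ∂μ, x ∉ γ.1)
    {G : Config d × (EucSp d × EucSp d) → ℝ≥0∞} (hG : Measurable G) :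
    ∫⁻ γ, ∫⁻ x, ∫⁻ y, G (γ, (x, y)) ∂γ.cnt ∂γ.cnt ∂μ
      = (∫⁻ p, gibbsWeight z φ p * G (p.2.ins p.1, (p.1, p.1)) ∂(volume.prod μ))
        + ∫⁻ q, gibbsWeight₂ z φ q * G ((q.2.ins q.1.2).ins q.1.1, q.1)
          ∂((volume.prod volume).prod μ) := by
  let F₁ : EucSp d × Config d → ℝ≥0∞ := fun p => G (p.2, (p.1, p.1))
  let F₂ : EucSp d × Config d → ℝ≥0∞ := fun p => ∫⁻ y, G (p.2, (p.1, y)) ∂(p.2.del p.1).cnt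
  have hF₁ : Measurable F₁ :=
    hG.comp (measurable_snd.prodMk (measurable_fst.prodMk measurable_fst))
  have hF₂ : Measurable F₂ := measurable_lintegral_cnt Config.measurable_del
    (hG.comp ((measurable_snd.comp measurable_fst).prodMk
      ((measurable_fst.comp measurable_fst).prodMk measurable_snd)))
  have hsplit : ∀ γ : Config d, ∫⁻ x, ∫⁻ y, G (γ, (x, y)) ∂γ.cnt ∂γ.cnt
      = ∫⁻ x, (F₁ + F₂) (x, γ) ∂γ.cnt := fun γ => by
    rw [Config.lintegral_cnt, Config.lintegral_cnt]
    exact tsum_congr fun x => γ.lintegral_cnt_eq_add_del x.2 _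
  simp only [hsplit]
  rw [h.lintegral_point hφ (hF₁.add hF₂)]
  simp only [Pi.add_apply, mul_add]
  have hm : Measurable fun p : EucSp d × Config d =>
      gibbsWeight z φ p * F₁ (p.1, p.2.ins p.1) :=
    (measurable_gibbsWeight hφ).mul (hF₁.comp (measurable_fst.prodMk Config.measurable_ins))
  rw [lintegral_add_left hm]
  congr 1
  have hA : Measurable fun p : EucSp d × Config d =>
      gibbsWeight z φ p * F₂ (p.1, p.2.ins p.1) :=
    (measurable_gibbsWeight hφ).mul (hF₂.comp (measurable_fst.prodMk Config.measurable_ins))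
  let H : (EucSp d × EucSp d) × Config d → ℝ≥0∞ := fun q =>
    gibbsWeight₂ z φ q * G ((q.2.ins q.1.2).ins q.1.1, q.1)
  have hins : Measurable fun q : (EucSp d × EucSp d) × Config d => q.2.ins q.1.2 :=
    Config.measurable_ins.comp ((measurable_snd.comp measurable_fst).prodMk measurable_snd)
  have hH : Measurable H := (measurable_gibbsWeight₂ hφ).mul (hG.comp
    ((Config.measurable_ins.comp ((measurable_fst.comp measurable_fst).prodMk hins)).prodMk
      measurable_fst))
  change _ = ∫⁻ q, H q ∂((volume.prod volume).prod μ)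
  rw [lintegral_prod _ hA.aemeasurable, lintegral_prod _ hH.aemeasurable,
    lintegral_prod _ (hH.lintegral_prod_right').aemeasurable]
  refine lintegral_congr fun x => ?_
  let F₃ : EucSp d × Config d → ℝ≥0∞ := fun p =>
    gibbsWeight z φ (x, p.2) * G (p.2.ins x, (x, p.1))
  have hF₃ : Measurable F₃ := by
    have hx : Measurable fun p : EucSp d × Config d => (x, p.2) :=
      measurable_const.prodMk measurable_snd
    exact ((measurable_gibbsWeight hφ).comp hx).mul (hG.comp
      ((Config.measurable_ins.comp hx).prodMk (measurable_const.prodMk measurable_fst)))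
  have h1 : ∫⁻ γ, gibbsWeight z φ (x, γ) * F₂ (x, γ.ins x) ∂μ
      = ∫⁻ γ, ∫⁻ y, F₃ (y, γ) ∂γ.cnt ∂μ := by
    refine lintegral_congr_ae ?_
    filter_upwards [hns x] with γ hγ
    simp only [F₂, F₃, Config.del_ins γ hγ]
    rw [lintegral_const_mul]
    exact hG.comp (measurable_const.prodMk (measurable_const.prodMk measurable_id))
  rw [h1, h.lintegral_point hφ hF₃, lintegral_prod]
  · refine lintegral_congr fun y => lintegral_congr fun γ => ?_
    simp only [F₃, H, gibbsWeight₂, mul_assoc]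
  · exact ((measurable_gibbsWeight hφ).mul
      (hF₃.comp (measurable_fst.prodMk Config.measurable_ins))).aemeasurable

/-- Signed two-point Campbell formula. -/
theorem GNZ.integral_pair {d : ℕ} {z : ℝ} {φ : EucSp d → EReal} {μ : Measure (Config d)}
    [SFinite μ] (h : GNZ z φ μ) (hφ : Measurable φ) (hns : ∀ x : EucSp d, ∀ᵐ γ ∂μ, x ∉ γ.1)
    {G : Config d × (EucSp d × EucSp d) → ℝ} (hG : Measurable G)
    (hfin₁ : ∀ᵐ p ∂(volume.prod μ), gibbsWeight z φ p < ∞)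
    (hfin₂ : ∀ᵐ q ∂((volume.prod volume).prod μ), gibbsWeight₂ z φ q < ∞)
    (hI₁ : Integrable (fun p : EucSp d × Config d =>
      (gibbsWeight z φ p).toReal * G (p.2.ins p.1, (p.1, p.1))) (volume.prod μ))
    (hI₂ : Integrable (fun q : (EucSp d × EucSp d) × Config d =>
      (gibbsWeight₂ z φ q).toReal * G ((q.2.ins q.1.2).ins q.1.1, q.1))
        ((volume.prod volume).prod μ)) :
    ∫ γ, ∫ p, G (γ, p) ∂(γ.cnt.prod γ.cnt) ∂μ
      = (∫ p, (gibbsWeight z φ p).toReal * G (p.2.ins p.1, (p.1, p.1)) ∂(volume.prod μ))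
        + ∫ q, (gibbsWeight₂ z φ q).toReal * G ((q.2.ins q.1.2).ins q.1.1, q.1)
          ∂((volume.prod volume).prod μ) := by
  let T₁ : EucSp d × Config d → Config d × (EucSp d × EucSp d) := fun p =>
    (p.2.ins p.1, (p.1, p.1))
  let T₂ : (EucSp d × EucSp d) × Config d → Config d × (EucSp d × EucSp d) := fun q =>
    ((q.2.ins q.1.2).ins q.1.1, q.1)
  have hT₁ : Measurable T₁ :=
    Config.measurable_ins.prodMk (measurable_fst.prodMk measurable_fst)
  have hT₂ : Measurable T₂ := by
    have hins : Measurable fun q : (EucSp d × EucSp d) × Config d => q.2.ins q.1.2 :=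
      Config.measurable_ins.comp ((measurable_snd.comp measurable_fst).prodMk measurable_snd)
    exact (Config.measurable_ins.comp ((measurable_fst.comp measurable_fst).prodMk hins)).prodMk
      measurable_fst
  have hw₁ := measurable_gibbsWeight (z := z) hφ
  have hw₂ := measurable_gibbsWeight₂ (z := z) hφ
  let ν₁ := (volume.prod μ).withDensity (gibbsWeight z φ)
  let ν₂ := ((volume.prod volume).prod μ).withDensity (gibbsWeight₂ z φ)
  have hM : μ ⊗ₘ (cntKernel d ×ₖ cntKernel d) = ν₁.map T₁ + ν₂.map T₂ := by
    refine Measure.ext_of_lintegral _ fun g hg => ?_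
    rw [Measure.lintegral_compProd hg, lintegral_add_measure, lintegral_map hg hT₁,
      lintegral_map hg hT₂]
    have e₁ : ∫⁻ p, g (T₁ p) ∂ν₁ = ∫⁻ p, gibbsWeight z φ p * g (T₁ p) ∂(volume.prod μ) :=
      lintegral_withDensity_eq_lintegral_mul _ hw₁ (hg.comp hT₁)
    have e₂ : ∫⁻ q, g (T₂ q) ∂ν₂
        = ∫⁻ q, gibbsWeight₂ z φ q * g (T₂ q) ∂((volume.prod volume).prod μ) :=
      lintegral_withDensity_eq_lintegral_mul _ hw₂ (hg.comp hT₂)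
    rw [e₁, e₂]
    have := h.lintegral_pair hφ hns hg
    refine Eq.trans (lintegral_congr fun γ => ?_) this
    rw [Kernel.lintegral_prod]
    · rfl
    · exact hg.comp (measurable_const.prodMk measurable_id)
  have i₁ : Integrable G (ν₁.map T₁) := by
    rw [integrable_map_measure hG.aestronglyMeasurable hT₁.aemeasurable]
    rw [integrable_withDensity_iff_integrable_smul' hw₁ hfin₁]
    exact hI₁
  have i₂ : Integrable G (ν₂.map T₂) := by
    rw [integrable_map_measure hG.aestronglyMeasurable hT₂.aemeasurable]
    rw [integrable_withDensity_iff_integrable_smul' hw₂ hfin₂]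
    exact hI₂
  have hGi : Integrable G (μ ⊗ₘ (cntKernel d ×ₖ cntKernel d)) := hM ▸ i₁.add_measure i₂
  have h1 := Measure.integral_compProd hGi
  simp only [Kernel.prod_apply, cntKernel_apply] at h1
  rw [← h1, hM, integral_add_measure i₁ i₂, integral_map hT₁.aemeasurable hG.aestronglyMeasurable,
    integral_map hT₂.aemeasurable hG.aestronglyMeasurable,
    integral_withDensity_eq_integral_toReal_smul hw₁ hfin₁,
    integral_withDensity_eq_integral_toReal_smul hw₂ hfin₂]
  rfl

/-- The sum of `∏ g (x_i)` over ordered `n`-tuples of distinct points of a configuration. -/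
def tupleSum {d : ℕ} (n : ℕ) (g : EucSp d → ℝ≥0∞) (γ : Config d) : ℝ≥0∞ :=
  ∑' p : injTuples n γ.1, ∏ i, g (p.1 i)

/-- A tuple of `n + 1` distinct points is a point together with `n` distinct other points. -/
def injTuplesEquiv {d : ℕ} (n : ℕ) (γ : Config d) :
    injTuples (n + 1) γ.1 ≃ Σ x : γ.1, injTuples n (γ.del x.1).1 where
  toFun p := ⟨⟨p.1 0, p.2.2 0⟩, ⟨Fin.tail p.1,
    ⟨fun i j h => Fin.succ_injective n (p.2.1 h),
      fun i => ⟨p.2.2 i.succ, fun h => Fin.succ_ne_zero i (p.2.1 h)⟩⟩⟩⟩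
  invFun q := ⟨Fin.cons q.1.1 q.2.1,
    ⟨Fin.cons_injective_iff.2 ⟨fun ⟨i, hi⟩ => (q.2.2.2 i).2 hi, q.2.2.1⟩,
      fun i => by
        refine Fin.cases ?_ (fun j => ?_) i
        · exact q.1.2
        · exact (q.2.2.2 j).1⟩⟩
  left_inv p := Subtype.ext (Fin.cons_self_tail p.1)
  right_inv q := rfl

theorem tupleSum_zero {d : ℕ} (g : EucSp d → ℝ≥0∞) (γ : Config d) : tupleSum 0 g γ = 1 := by
  have : Unique (injTuples 0 γ.1) :=
    { default := ⟨Fin.elim0, ⟨fun i => i.elim0, fun i => i.elim0⟩⟩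
      uniq := fun p => Subtype.ext (Subsingleton.elim _ _) }
  simp [tupleSum]

theorem tupleSum_succ {d : ℕ} (n : ℕ) (g : EucSp d → ℝ≥0∞) (γ : Config d) :
    tupleSum (n + 1) g γ = ∑' x : γ.1, g x.1 * tupleSum n g (γ.del x.1) := by
  rw [tupleSum, ← (injTuplesEquiv n γ).symm.tsum_eq]
  refine (ENNReal.tsum_sigma' _).trans (tsum_congr fun x => ?_)
  rw [tupleSum, ← ENNReal.tsum_mul_left]
  refine tsum_congr fun q => ?_
  rw [Fin.prod_univ_succ]
  rfl

theorem measurable_tupleSum {d : ℕ} {g : EucSp d → ℝ≥0∞} (hg : Measurable g) (n : ℕ) :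
    Measurable (tupleSum n g) := by
  induction n with
  | zero => simp only [funext (tupleSum_zero g), measurable_const]
  | succ n ih =>
    have : tupleSum (n + 1) g
        = fun γ : Config d => ∫⁻ x, g x * tupleSum n g (γ.del x) ∂γ.cnt := by
      ext γ; rw [tupleSum_succ, Config.lintegral_cnt]
    rw [this]
    exact measurable_lintegral_cnt measurable_id ((hg.comp measurable_snd).mul
      (ih.comp (Config.measurable_del.comp (measurable_snd.prodMk measurable_fst))))

theorem lintegral_prod_fin_eq_pow {α : Type*} [MeasureSpace α] [SigmaFinite (volume : Measure α)]
    {g : α → ℝ≥0∞} (hg : Measurable g) (n : ℕ) :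
    ∫⁻ x : Fin n → α, ∏ i, g (x i) = (∫⁻ x, g x) ^ n := by
  induction n with
  | zero => simp [volume_pi]
  | succ n ih =>
    have hm : Measurable fun x : Fin n → α => ∏ i, g (x i) :=
      Finset.measurable_prod _ fun i _ => hg.comp (measurable_pi_apply i)
    have e := (volume_preserving_piFinSuccAbove (fun _ : Fin (n + 1) => α) 0).symm
    rw [← e.lintegral_comp_emb (MeasurableEquiv.measurableEmbedding _), pow_succ', ← ih]
    rw [← lintegral_prod_mul hg.aemeasurable hm.aemeasurable]
    refine lintegral_congr fun p => ?_
    simp [Fin.prod_univ_succ, MeasurableEquiv.piFinSuccAbove]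

theorem lintegral_tupleSum_le {d : ℕ} {μ : Measure (Config d)} [IsProbabilityMeasure μ]
    {k : ∀ n : ℕ, (Fin n → EucSp d) → ℝ} {ξ : ℝ} (hk : HasCorrFns μ k) (hR : RuelleBound k ξ)
    {g : EucSp d → ℝ≥0∞} (hg : Measurable g) (n : ℕ) :
    ∫⁻ γ, tupleSum n g γ ∂μ ≤ (ENNReal.ofReal |ξ| * ∫⁻ x, g x) ^ n := by
  rcases Nat.eq_zero_or_pos n with rfl | hn
  · simp [tupleSum_zero]
  have hm : Measurable fun x : Fin n → EucSp d => ∏ i, g (x i) :=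
    Finset.measurable_prod _ fun i _ => hg.comp (measurable_pi_apply i)
  have h := hk.2 n hn (fun x => ∏ i, g (x i)) hm
    (fun σ x => Equiv.prod_comp σ fun i => g (x i))
  calc ∫⁻ γ, tupleSum n g γ ∂μ
      = ∫⁻ x : Fin n → EucSp d, (∏ i, g (x i)) * ENNReal.ofReal (k n x) := h
    _ ≤ ∫⁻ x : Fin n → EucSp d, (∏ i, g (x i)) * ENNReal.ofReal |ξ| ^ n := by
        refine lintegral_mono fun x => mul_le_mul_right ?_ _
        rw [← ENNReal.ofReal_pow (abs_nonneg _)]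
        refine ENNReal.ofReal_le_ofReal ((hR n hn x).trans ?_)
        rw [← abs_pow]; exact le_abs_self _
    _ = (ENNReal.ofReal |ξ| * ∫⁻ x, g x) ^ n := by
        rw [lintegral_mul_const _ hm, mul_pow, mul_comm,
          lintegral_prod_fin_eq_pow hg]

/-- The sum of `∏ g (x_i)` over all finite subsets of a configuration. -/
def subsetSum {d : ℕ} (g : EucSp d → ℝ≥0∞) (γ : Config d) : ℝ≥0∞ :=
  ∑' n : ℕ, (n.factorial : ℝ≥0∞)⁻¹ * tupleSum n g γ

theorem lintegral_subsetSum_le {d : ℕ} {μ : Measure (Config d)} [IsProbabilityMeasure μ]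
    {k : ∀ n : ℕ, (Fin n → EucSp d) → ℝ} {ξ : ℝ} (hk : HasCorrFns μ k) (hR : RuelleBound k ξ)
    {g : EucSp d → ℝ≥0∞} (hg : Measurable g) {A : ℝ} (hA : 0 ≤ A)
    (hgA : ∫⁻ x, g x ≤ ENNReal.ofReal A) :
    ∫⁻ γ, subsetSum g γ ∂μ ≤ ENNReal.ofReal (Real.exp (|ξ| * A)) := by
  have hm := measurable_tupleSum hg
  unfold subsetSum
  rw [lintegral_tsum fun n => ((hm n).const_mul _).aemeasurable, Real.exp_eq_exp_ℝ,
    NormedSpace.exp_eq_tsum_div,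
    ENNReal.ofReal_tsum_of_nonneg (fun n => by positivity) (Real.summable_pow_div_factorial _)]
  refine ENNReal.tsum_le_tsum fun n => ?_
  rw [lintegral_const_mul _ (hm n), div_eq_inv_mul, ENNReal.ofReal_mul (by positivity),
    ENNReal.ofReal_inv_of_pos (by positivity), ENNReal.ofReal_natCast,
    ENNReal.ofReal_pow (by positivity), ENNReal.ofReal_mul (abs_nonneg _)]
  exact mul_le_mul_right ((lintegral_tupleSum_le hk hR hg n).trans (by gcongr)) _

theorem Finset.sum_mul_sum_powersetCard_erase {α R : Type*} [DecidableEq α] [CommSemiring R]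
    (S : Finset α) (g : α → R) (n : ℕ) :
    ∑ x ∈ S, g x * ∑ t ∈ (S.erase x).powersetCard n, ∏ y ∈ t, g y
      = (n + 1) * ∑ t ∈ S.powersetCard (n + 1), ∏ y ∈ t, g y := by
  have h1 : ∀ t ∈ S.powersetCard (n + 1), ((n : R) + 1) * ∏ y ∈ t, g y
      = ∑ x ∈ t, g x * ∏ y ∈ t.erase x, g y := fun t ht => by
    rw [Finset.sum_congr rfl fun x hx => Finset.mul_prod_erase t g hx, Finset.sum_const,
      (Finset.mem_powersetCard.1 ht).2]
    simp
  rw [Finset.mul_sum, Finset.sum_congr rfl h1]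
  simp only [Finset.mul_sum]
  rw [Finset.sum_sigma', Finset.sum_sigma']
  refine Finset.sum_bij' (fun p _ => ⟨insert p.1 p.2, p.1⟩) (fun q _ => ⟨q.2, q.1.erase q.2⟩)
    ?_ ?_ ?_ ?_ ?_
  · rintro ⟨x, t⟩ h
    simp only [Finset.mem_sigma, Finset.mem_powersetCard, Finset.subset_erase] at h ⊢
    exact ⟨⟨Finset.insert_subset h.1 h.2.1.1, by rw [Finset.card_insert_of_notMem h.2.1.2, h.2.2]⟩,
      Finset.mem_insert_self _ _⟩
  · rintro ⟨t, x⟩ h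
    simp only [Finset.mem_sigma, Finset.mem_powersetCard] at h ⊢
    exact ⟨h.1.1 h.2, Finset.erase_subset_erase _ h.1.1, by
      rw [Finset.card_erase_of_mem h.2, h.1.2]; rfl⟩
  · rintro ⟨x, t⟩ h
    simp only [Finset.mem_sigma, Finset.mem_powersetCard, Finset.subset_erase] at h
    simp [Finset.erase_insert h.2.1.2]
  · rintro ⟨t, x⟩ h
    simp only [Finset.mem_sigma] at h
    simp [Finset.insert_erase h.2]
  · rintro ⟨x, t⟩ h
    simp only [Finset.mem_sigma, Finset.mem_powersetCard, Finset.subset_erase] at h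
    simp [Finset.erase_insert h.2.1.2]

theorem factorial_mul_sum_powersetCard_le {d : ℕ} (g : EucSp d → ℝ≥0∞) (n : ℕ) :
    ∀ (γ : Config d) (S : Finset (EucSp d)), (S : Set (EucSp d)) ⊆ γ.1 →
      (n.factorial : ℝ≥0∞) * ∑ t ∈ S.powersetCard n, ∏ y ∈ t, g y ≤ tupleSum n g γ := by
  induction n with
  | zero => intro γ S _; simp [tupleSum_zero]
  | succ n ih =>
    intro γ S hS
    rw [tupleSum_succ, Nat.factorial_succ, mul_comm (n + 1), Nat.cast_mul, mul_assoc,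
      Nat.cast_succ, ← Finset.sum_mul_sum_powersetCard_erase, Finset.mul_sum,
      tsum_subtype γ.1 fun x => g x * tupleSum n g (γ.del x)]
    refine le_trans (Finset.sum_le_sum fun x hx => ?_) (ENNReal.sum_le_tsum S)
    rw [Set.indicator_of_mem (hS hx), mul_left_comm]
    refine mul_le_mul_right (ih (γ.del x) _ ?_) _
    rw [Finset.coe_erase]
    exact Set.sdiff_subset_sdiff_left hS

theorem prod_one_add_le_subsetSum {d : ℕ} (g : EucSp d → ℝ≥0∞) (γ : Config d)
    (S : Finset (EucSp d)) (hS : (S : Set (EucSp d)) ⊆ γ.1) :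
    ∏ y ∈ S, (1 + g y) ≤ subsetSum g γ := by
  rw [Finset.prod_one_add, Finset.sum_powerset]
  refine le_trans (Finset.sum_le_sum fun n _ => ?_) (ENNReal.sum_le_tsum (Finset.range (S.card + 1)))
  have h := factorial_mul_sum_powersetCard_le g n γ S hS
  rwa [← inv_inv (n.factorial : ℝ≥0∞), ENNReal.inv_mul_le_iff (by simp)
    (by simp [Nat.factorial_ne_zero])] at h

theorem ofReal_exp_tsum_le_subsetSum {d : ℕ} {g : EucSp d → ℝ≥0∞} {v : EucSp d → ℝ}
    {γ : Config d} (hv : Summable fun y : γ.1 => v y.1)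
    (hg : ∀ y, ENNReal.ofReal (Real.exp (v y)) ≤ 1 + g y) :
    ENNReal.ofReal (Real.exp (∑' y : γ.1, v y.1)) ≤ subsetSum g γ := by
  have h1 : Tendsto (fun S : Finset γ.1 => ENNReal.ofReal (Real.exp (∑ y ∈ S, v y.1))) atTop
      (𝓝 (ENNReal.ofReal (Real.exp (∑' y : γ.1, v y.1)))) :=
    (ENNReal.continuous_ofReal.comp Real.continuous_exp).continuousAt.tendsto.comp hv.hasSum
  refine le_of_tendsto' h1 fun S => ?_
  refine le_trans ?_ (prod_one_add_le_subsetSum g γ (S.map (Function.Embedding.subtype _)) ?_)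
  · rw [Real.exp_sum, ENNReal.ofReal_prod_of_nonneg fun _ _ => (Real.exp_pos _).le,
      Finset.prod_map]
    exact Finset.prod_le_prod' fun y _ => hg y
  · intro y hy
    simp only [Finset.coe_map, Set.mem_image] at hy
    obtain ⟨x, -, rfl⟩ := hy
    exact x.2

theorem measurable_lintegral_cnt_const {d : ℕ} {g : EucSp d → ℝ≥0∞} (hg : Measurable g) :
    Measurable fun γ : Config d => ∫⁻ x, g x ∂γ.cnt :=
  measurable_lintegral_cnt (T := id) (g := fun _ => g) measurable_id (hg.comp measurable_snd)

theorem abs_exp_mul_sub_one_le {c t : ℝ} (hc0 : 0 ≤ c) (hc1 : c ≤ 1) :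
    |Real.exp (c * t) - 1| ≤ |Real.exp t - 1| := by
  rcases le_total 0 t with ht | ht
  · have h1 : 1 ≤ Real.exp (c * t) := Real.one_le_exp (mul_nonneg hc0 ht)
    have h2 : Real.exp (c * t) ≤ Real.exp t := Real.exp_le_exp.2 (by nlinarith)
    rw [abs_of_nonneg (by linarith), abs_of_nonneg (by linarith)]
    linarith
  · have h1 : Real.exp (c * t) ≤ 1 := Real.exp_le_one_iff.2 (mul_nonpos_of_nonneg_of_nonpos hc0 ht)
    have h2 : Real.exp t ≤ Real.exp (c * t) := Real.exp_le_exp.2 (by nlinarith)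
    rw [abs_of_nonpos (by linarith), abs_of_nonpos (by linarith)]
    linarith

theorem abs_le_exp_mul_abs_exp_neg_sub_one {C t : ℝ} (ht : |t| ≤ C) :
    |t| ≤ Real.exp C * |Real.exp (-t) - 1| := by
  have h3 : 1 ≤ Real.exp C := Real.one_le_exp ((abs_nonneg t).trans ht)
  rcases le_total 0 t with h | h
  · rw [abs_of_nonneg h] at ht ⊢
    have h1 : Real.exp (-t) ≤ 1 := Real.exp_le_one_iff.2 (by linarith)
    have h2 : t + 1 ≤ Real.exp t := Real.add_one_le_exp t
    have h4 : Real.exp t ≤ Real.exp C := Real.exp_le_exp.2 ht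
    have h5 : Real.exp t * Real.exp (-t) = 1 := by rw [← Real.exp_add]; simp
    rw [abs_of_nonpos (by linarith)]
    nlinarith
  · rw [abs_of_nonpos h] at ht ⊢
    have h2 : -t + 1 ≤ Real.exp (-t) := Real.add_one_le_exp (-t)
    rw [abs_of_nonneg (by linarith)]
    nlinarith

theorem abs_exp_neg_toReal_sub_one_le {d : ℕ} {φ : EucSp d → EReal} (hφ : IsPairPotential φ)
    {c : ℝ} (hc0 : 0 ≤ c) (hc1 : c ≤ 1) (u : EucSp d) :
    |Real.exp (-(c * (φ u).toReal)) - 1| ≤ |rexp (-(φ u)) - 1| := by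
  rcases eq_or_ne (φ u) ⊤ with h | h
  · simp [h]
  · have h1 : -(φ u) = ((-(φ u).toReal : ℝ) : EReal) := by
      rw [EReal.coe_neg, EReal.coe_toReal h (hφ.ne_bot u)]
    rw [h1, rexp_coe, ← mul_neg]
    exact abs_exp_mul_sub_one_le hc0 hc1

theorem Stable.neg_le_toReal {d : ℕ} {φ : EucSp d → EReal} {B : ℝ} (h : Stable φ B)
    (hφ : IsPairPotential φ) {u : EucSp d} (hu : u ≠ 0) : -(2 * B) ≤ (φ u).toReal := by
  have h1 := h {u, 0}
  have h2 : ({u, 0} : Finset (EucSp d)).offDiag = {(u, 0), (0, u)} := by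
    ext ⟨a, b⟩
    simp only [Finset.mem_offDiag, Finset.mem_insert, Finset.mem_singleton, Prod.mk.injEq]
    constructor
    · rintro ⟨rfl | rfl, rfl | rfl, h⟩ <;> simp_all
    · rintro (⟨rfl, rfl⟩ | ⟨rfl, rfl⟩) <;> simp [hu, hu.symm]
  have h3 : ((u, 0) : EucSp d × EucSp d) ≠ (0, u) := fun h => hu (Prod.ext_iff.1 h).1
  rw [h2, Finset.sum_pair h3, Finset.card_pair hu] at h1
  simp only [sub_zero, zero_sub, hφ.even u hu] at h1
  rw [← EReal.coe_toReal (hφ.finite_off u hu) (hφ.ne_bot u), ← EReal.coe_add,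
    EReal.coe_le_coe_iff] at h1
  push_cast at h1
  linarith

theorem exp_neg_mul_le {B c t : ℝ} (hB : 0 ≤ B) (hc0 : 0 ≤ c) (hc1 : c ≤ 1) (ht : -(2 * B) ≤ t) :
    Real.exp (-(c * t)) ≤ Real.exp (2 * B) :=
  Real.exp_le_exp.2 (by nlinarith)

namespace Setting

variable {d : ℕ} {s z B ξ : ℝ} {φ : EucSp d → EReal} {μ : Measure (Config d)}
  {k u : ∀ n : ℕ, (Fin n → EucSp d) → ℝ}

theorem lintegral_mayer_lt_top (h : Setting d s z B ξ φ μ k u) :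
    ∫⁻ x, ENNReal.ofReal |rexp (-(φ x)) - 1| < ∞ := by
  have h1 : ∫⁻ x : EucSp d, ENNReal.ofReal (|rexp (-(φ x)) - 1| * z) < ∞ :=
    lt_of_lt_of_le h.laht le_top
  simp only [ENNReal.ofReal_mul (abs_nonneg _)] at h1
  rw [lintegral_mul_const' _ _ ENNReal.ofReal_ne_top] at h1
  exact (ENNReal.mul_lt_top_iff.1 h1).elim (fun h => h.1) fun h' => h'.elim
    (fun h0 => by simp [h0]) fun h0 => absurd h0 (by simpa using h.hz)

theorem measurable_mayer (h : Setting d s z B ξ φ μ k u) :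
    Measurable fun x => ENNReal.ofReal |rexp (-(φ x)) - 1| :=
  (((measurable_rexp.comp h.pp.meas.neg).sub_const 1).abs).ennreal_ofReal

theorem lintegral_cnt_le (h : Setting d s z B ξ φ μ k u) {g : EucSp d → ℝ≥0∞}
    (hg : Measurable g) :
    ∫⁻ γ, ∫⁻ x, g x ∂γ.cnt ∂μ ≤ ENNReal.ofReal |ξ| * ∫⁻ x, g x := by
  have := h.prob
  have h1 := lintegral_tupleSum_le h.corr h.ruelle hg 1
  simpa [tupleSum_succ, tupleSum_zero, Config.lintegral_cnt] using h1

theorem ae_notMem (h : Setting d s z B ξ φ μ k u) (x : EucSp d) : ∀ᵐ γ ∂μ, x ∉ γ.1 := by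
  have : Nonempty (Fin d) := ⟨⟨0, h.hd⟩⟩
  have hg : Measurable (({x} : Set (EucSp d)).indicator (1 : EucSp d → ℝ≥0∞)) :=
    measurable_one.indicator (measurableSet_singleton x)
  have h1 := h.lintegral_cnt_le hg
  rw [lintegral_indicator_one (measurableSet_singleton x), measure_singleton, mul_zero,
    nonpos_iff_eq_zero, lintegral_eq_zero_iff
      (measurable_lintegral_cnt_const hg)] at h1
  filter_upwards [h1] with γ hγ hx
  have h2 : ∫⁻ y, ({x} : Set (EucSp d)).indicator (1 : EucSp d → ℝ≥0∞) y ∂γ.cnt = 0 := hγ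
  rw [Config.lintegral_cnt, ENNReal.tsum_eq_zero] at h2
  simpa using h2 ⟨x, hx⟩

theorem ae_tempered (h : Setting d s z B ξ φ μ k u) (x : EucSp d) :
    ∀ᵐ γ ∂μ, Tempered φ x γ := by
  obtain ⟨R, C, hRC⟩ := h.bddOutside
  let g : EucSp d → ℝ≥0∞ := fun y =>
    if R ≤ ‖x - y‖ then ‖(φ (x - y)).toReal‖ₑ else 0
  have hsub : Measurable fun y : EucSp d => x - y := measurable_const.sub measurable_id
  have hg : Measurable g := Measurable.ite (measurableSet_le measurable_const hsub.norm)
    (h.pp.meas.comp hsub).ereal_toReal.enorm measurable_const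
  have hgle : ∫⁻ y, g y < ∞ := by
    calc ∫⁻ y, g y
        ≤ ∫⁻ y, ENNReal.ofReal (Real.exp C) * ENNReal.ofReal |rexp (-(φ (x - y))) - 1| := by
          refine lintegral_mono fun y => ?_
          simp only [g]
          split_ifs with hy
          · obtain ⟨r, hr, hrC⟩ := hRC _ hy
            rw [← ENNReal.ofReal_mul (Real.exp_pos _).le, hr, EReal.toReal_coe, ← EReal.coe_neg,
              rexp_coe, Real.enorm_eq_ofReal_abs]
            exact ENNReal.ofReal_le_ofReal (abs_le_exp_mul_abs_exp_neg_sub_one hrC)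
          · exact zero_le
      _ = ENNReal.ofReal (Real.exp C) * ∫⁻ y, ENNReal.ofReal |rexp (-(φ y)) - 1| := by
          rw [lintegral_const_mul' _ _ ENNReal.ofReal_ne_top,
            lintegral_sub_left_eq_self fun y => ENNReal.ofReal |rexp (-(φ y)) - 1|]
      _ < ∞ := ENNReal.mul_lt_top ENNReal.ofReal_lt_top h.lintegral_mayer_lt_top
  have h1 : ∫⁻ γ, ∫⁻ y, g y ∂γ.cnt ∂μ < ∞ :=
    (h.lintegral_cnt_le hg).trans_lt (ENNReal.mul_lt_top ENNReal.ofReal_lt_top hgle)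
  have h2 := ae_lt_top (measurable_lintegral_cnt_const hg) h1.ne
  filter_upwards [h2, h.ae_notMem x] with γ hγ hx
  refine ⟨hx, ?_⟩
  have h3 : Summable fun y : γ.1 => if R ≤ ‖x - y.1‖ then (φ (x - y.1)).toReal else 0 := by
    refine (γ.summable_iff fun y => if R ≤ ‖x - y‖ then (φ (x - y)).toReal else 0).2 ?_
    refine lt_of_le_of_lt (lintegral_mono fun y => ?_) hγ
    simp only [g]
    split_ifs <;> simp
  have h4 : Summable fun y : γ.1 => if R ≤ ‖x - y.1‖ then 0 else (φ (x - y.1)).toReal := by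
    refine summable_of_hasFiniteSupport ?_
    have := γ.2 _ (isCompact_closedBall x R)
    refine (this.preimage (f := ((↑) : γ.1 → EucSp d)) Subtype.val_injective.injOn).subset ?_
    intro y hy
    refine ⟨y.2, ?_⟩
    rw [Metric.mem_closedBall', dist_eq_norm]
    by_contra hlt
    exact hy (if_pos (not_le.1 hlt).le)
  refine (h3.add h4).congr fun y => ?_
  split_ifs <;> simp

theorem exists_lintegral_exp_le (h : Setting d s z B ξ φ μ k u) {f : EucSp d → ℝ} (hf : IsC0 f) :
    ∃ C : ℝ, ∀ c₁ c₂ : ℝ, 0 ≤ c₁ → c₁ ≤ 1 → 0 ≤ c₂ → c₂ ≤ 1 → ∀ x₁ x₂ : EucSp d,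
      ∫⁻ γ, ENNReal.ofReal (Real.exp (-(c₁ * realEnergy φ x₁ γ) + -(c₂ * realEnergy φ x₂ γ)
        + 2 * cpair f γ)) ∂μ ≤ ENNReal.ofReal C := by
  have := h.prob
  have : Nonempty (Fin d) := ⟨⟨0, h.hd⟩⟩
  obtain ⟨M, hM⟩ := hf.2.exists_bound_of_continuous hf.1
  let θ : EucSp d → ℝ≥0∞ := fun y => ENNReal.ofReal |rexp (-(φ y)) - 1|
  let b : EucSp d → ℝ≥0∞ := fun y => ENNReal.ofReal |Real.exp (2 * f y) - 1|
  let K : ℝ≥0∞ := ENNReal.ofReal (Real.exp (2 * M) * Real.exp (2 * B))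
  have hB1 : 1 ≤ Real.exp (2 * B) := Real.one_le_exp (by linarith [h.hB])
  have hbi : ∫⁻ y, b y < ∞ := by
    have h1 : Continuous fun y => Real.exp (2 * f y) - 1 :=
      (Real.continuous_exp.comp (continuous_const.mul hf.1)).sub continuous_const
    have h2 : HasCompactSupport fun y => Real.exp (2 * f y) - 1 :=
      hf.2.comp_left (g := fun t => Real.exp (2 * t) - 1) (by simp)
    have := (h1.integrable_of_hasCompactSupport h2 (μ := volume)).2
    simpa [HasFiniteIntegral, Real.enorm_eq_ofReal_abs] using this
  have hbm : Measurable b :=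
    (((Real.measurable_exp.comp (hf.1.measurable.const_mul 2)).sub_const 1).abs).ennreal_ofReal
  have hI := h.lintegral_mayer_lt_top
  let T : ℝ≥0∞ := K * (∫⁻ y, θ y) + K * (∫⁻ y, θ y) + ∫⁻ y, b y
  have hT : T < ∞ := ENNReal.add_lt_top.2 ⟨ENNReal.add_lt_top.2
    ⟨ENNReal.mul_lt_top ENNReal.ofReal_lt_top hI, ENNReal.mul_lt_top ENNReal.ofReal_lt_top hI⟩, hbi⟩
  refine ⟨Real.exp (|ξ| * T.toReal), fun c₁ c₂ h10 h11 h20 h21 x₁ x₂ => ?_⟩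
  let v : EucSp d → ℝ := fun y =>
    -(c₁ * (φ (x₁ - y)).toReal) + -(c₂ * (φ (x₂ - y)).toReal) + 2 * f y
  let g : EucSp d → ℝ≥0∞ := fun y => ENNReal.ofReal |Real.exp (v y) - 1|
  have hsub : ∀ x : EucSp d, Measurable fun y => (φ (x - y)).toReal := fun x =>
    (h.pp.meas.comp (measurable_const.sub measurable_id)).ereal_toReal
  have hg : Measurable g := by
    have : Measurable v := (((hsub x₁).const_mul c₁).neg.add ((hsub x₂).const_mul c₂).neg).add
      (hf.1.measurable.const_mul 2)
    exact (((Real.measurable_exp.comp this).sub_const 1).abs).ennreal_ofReal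
  have hθm : ∀ x : EucSp d, Measurable fun y => K * θ (x - y) := fun x =>
    (h.measurable_mayer.comp (measurable_const.sub measurable_id)).const_mul K
  have hgT : ∫⁻ y, g y ≤ ENNReal.ofReal T.toReal := by
    rw [ENNReal.ofReal_toReal hT.ne]
    have hne : ∀ᵐ y : EucSp d, y ≠ x₂ := by simp [ae_iff]
    calc ∫⁻ y, g y ≤ ∫⁻ y, (K * θ (x₁ - y) + K * θ (x₂ - y) + b y) := by
          refine lintegral_mono_ae ?_
          filter_upwards [hne] with y hy
          have e1 := abs_exp_neg_toReal_sub_one_le h.pp h10 h11 (x₁ - y)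
          have e2 := abs_exp_neg_toReal_sub_one_le h.pp h20 h21 (x₂ - y)
          have e3 := exp_neg_mul_le h.hB h20 h21
            (h.stable.neg_le_toReal h.pp (sub_ne_zero.2 (Ne.symm hy)))
          have e4 : Real.exp (2 * f y) ≤ Real.exp (2 * M) :=
            Real.exp_le_exp.2 (by linarith [(le_abs_self _).trans (hM y)])
          simp only [g, K, θ, b]
          rw [← ENNReal.ofReal_mul (by positivity), ← ENNReal.ofReal_mul (by positivity),
            ← ENNReal.ofReal_add (by positivity) (by positivity),
            ← ENNReal.ofReal_add (by positivity) (by positivity)]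
          refine ENNReal.ofReal_le_ofReal ?_
          simp only [v]
          rw [Real.exp_add, Real.exp_add]
          set A₁ := Real.exp (-(c₁ * (φ (x₁ - y)).toReal))
          set A₂ := Real.exp (-(c₂ * (φ (x₂ - y)).toReal)) with hA₂
          set b' := Real.exp (2 * f y) with hb'
          have p2 : 0 < A₂ := Real.exp_pos _
          have p3 : 0 < b' := Real.exp_pos _
          have : A₁ * A₂ * b' - 1 = b' * A₂ * (A₁ - 1) + b' * (A₂ - 1) + (b' - 1) := by ring
          rw [this]
          refine (abs_add_three _ _ _).trans ?_
          rw [abs_mul (b' * A₂), abs_mul b' (A₂ - 1), abs_of_pos (mul_pos p3 p2), abs_of_pos p3]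
          have q1 : b' * A₂ ≤ Real.exp (2 * M) * Real.exp (2 * B) :=
            mul_le_mul e4 e3 p2.le (Real.exp_pos _).le
          have q2 : b' ≤ Real.exp (2 * M) * Real.exp (2 * B) :=
            e4.trans (le_mul_of_one_le_right (Real.exp_pos _).le hB1)
          gcongr
      _ = T := by
          have hm : Measurable fun y => K * θ (x₁ - y) + K * θ (x₂ - y) :=
            (hθm x₁).add (hθm x₂)
          rw [lintegral_add_left hm, lintegral_add_left (hθm x₁),
            lintegral_const_mul' _ _ ENNReal.ofReal_ne_top,
            lintegral_const_mul' _ _ ENNReal.ofReal_ne_top,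
            lintegral_sub_left_eq_self θ, lintegral_sub_left_eq_self θ]
  refine le_trans (lintegral_mono_ae ?_)
    (lintegral_subsetSum_le h.corr h.ruelle hg ENNReal.toReal_nonneg hgT)
  filter_upwards [h.ae_tempered x₁, h.ae_tempered x₂] with γ h₁ h₂
  have hs := ((h₁.2.hasSum.mul_left c₁).neg.add (h₂.2.hasSum.mul_left c₂).neg).add
    ((γ.summable_of_isC0 hf.2).hasSum.mul_left 2)
  have hv : HasSum (fun y : γ.1 => v y.1) (-(c₁ * realEnergy φ x₁ γ) + -(c₂ * realEnergy φ x₂ γ)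
        + 2 * cpair f γ) := hs
  rw [← hv.tsum_eq]
  refine ofReal_exp_tsum_le_subsetSum hv.summable fun y => ?_
  simp only [g]
  rw [← ENNReal.ofReal_one, ← ENNReal.ofReal_add zero_le_one (abs_nonneg _)]
  exact ENNReal.ofReal_le_ofReal (by linarith [le_abs_self (Real.exp (v y) - 1)])

end Setting

theorem integral_prod_of_lintegral_le {X Y : Type*} [MeasurableSpace X] [MeasurableSpace Y]
    {ν : Measure X} {μ : Measure Y} [SFinite ν] [SFinite μ] {g : X × Y → ℝ}
    (hg : AEStronglyMeasurable g (ν.prod μ)) {w : X → ℝ} (hw : Integrable w ν) {e : X → Y → ℝ}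
    (hge : ∀ᵐ q ∂(ν.prod μ), g q = w q.1 * e q.1 q.2) (he : ∀ x y, 0 ≤ e x y) {C : ℝ}
    (hC : ∀ x, ∫⁻ y, ENNReal.ofReal (e x y) ∂μ ≤ ENNReal.ofReal C) :
    Integrable g (ν.prod μ) ∧ Integrable (fun x => w x * ∫ y, e x y ∂μ) ν ∧
      ∫ q, g q ∂(ν.prod μ) = ∫ x, w x * ∫ y, e x y ∂μ ∂ν := by
  have hi : Integrable g (ν.prod μ) := by
    refine ⟨hg, ?_⟩
    calc ∫⁻ q, ‖g q‖ₑ ∂(ν.prod μ) ≤ ∫⁻ x, ∫⁻ y, ‖g (x, y)‖ₑ ∂μ ∂ν := (lintegral_prod_le _)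
      _ ≤ ∫⁻ x, ‖w x‖ₑ * ENNReal.ofReal C ∂ν := by
          refine lintegral_mono_ae ?_
          filter_upwards [Measure.ae_ae_of_ae_prod hge] with x hx
          calc ∫⁻ y, ‖g (x, y)‖ₑ ∂μ = ∫⁻ y, ‖w x‖ₑ * ENNReal.ofReal (e x y) ∂μ := by
                refine lintegral_congr_ae ?_
                filter_upwards [hx] with y hy
                rw [hy, enorm_mul, Real.enorm_of_nonneg (he x y)]
            _ = ‖w x‖ₑ * ∫⁻ y, ENNReal.ofReal (e x y) ∂μ :=
                lintegral_const_mul' _ _ enorm_ne_top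
            _ ≤ _ := by gcongr; exact hC x
      _ = (∫⁻ x, ‖w x‖ₑ ∂ν) * ENNReal.ofReal C := lintegral_mul_const' _ _ ENNReal.ofReal_ne_top
      _ < ∞ := ENNReal.mul_lt_top hw.2 ENNReal.ofReal_lt_top
  have hc : ∀ᵐ x ∂ν, ∫ y, g (x, y) ∂μ = w x * ∫ y, e x y ∂μ := by
    filter_upwards [Measure.ae_ae_of_ae_prod hge] with x hx
    rw [← integral_const_mul]
    exact integral_congr_ae hx
  refine ⟨hi, hi.integral_prod_left.congr hc, ?_⟩
  rw [integral_prod g hi]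
  exact integral_congr_ae hc

/-- The summand `exp[s E(x, γ ∖ x)] (D_x^- F)(γ)` for `F = e^{⟨f,·⟩}`. -/
def deathTerm {d : ℕ} (s : ℝ) (φ : EucSp d → EReal) (f : EucSp d → ℝ)
    (q : Config d × EucSp d) : ℝ :=
  rexp ((s : EReal) * energy φ q.2 (q.1.del q.2).1) *
    Dminus (fun γ' => Real.exp (cpair f γ')) q.2 q.1

theorem measurable_deathTerm {d : ℕ} {s : ℝ} {φ : EucSp d → EReal} {f : EucSp d → ℝ}
    (hφ : Measurable φ) (hf : Measurable f) : Measurable (deathTerm s φ f) := by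
  have hdel : Measurable fun q : Config d × EucSp d => q.1.del q.2 :=
    Config.measurable_del.comp measurable_swap
  refine Measurable.mul (measurable_rexp.comp (Measurable.const_mul
    ((measurable_energy hφ).comp (measurable_snd.prodMk hdel)) _)) ?_
  exact (Real.measurable_exp.comp ((measurable_cpair hf).comp hdel)).sub
    (Real.measurable_exp.comp ((measurable_cpair hf).comp measurable_fst))

theorem H0Minus_sq {d : ℕ} (s : ℝ) (φ : EucSp d → EReal) (f : EucSp d → ℝ) (γ : Config d) :
    (H0Minus s φ (fun γ' => Real.exp (cpair f γ')) γ) ^ 2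
      = ∫ p, deathTerm s φ f (γ, p.1) * deathTerm s φ f (γ, p.2) ∂(γ.cnt.prod γ.cnt) := by
  rw [integral_prod_mul (fun x => deathTerm s φ f (γ, x)) fun x => deathTerm s φ f (γ, x),
    Config.integral_cnt, ← sq, H0Minus, neg_sq]
  rfl

theorem Config.ins_comm {d : ℕ} (γ : Config d) (x y : EucSp d) :
    (γ.ins y).ins x = (γ.ins x).ins y := Subtype.ext (Set.insert_comm _ _ _)

theorem deathTerm_ins {d : ℕ} {s : ℝ} {φ : EucSp d → EReal} (hφ : IsPairPotential φ)
    {f : EucSp d → ℝ} (hf : HasCompactSupport f) {x : EucSp d} {γ : Config d}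
    (h : Tempered φ x γ) : deathTerm s φ f (γ.ins x, x)
      = Real.exp (s * realEnergy φ x γ) * (1 - Real.exp (f x)) * Real.exp (cpair f γ) := by
  rw [deathTerm, Dminus, γ.del_ins h.1, h.energy_eq hφ, ← EReal.coe_mul, rexp_coe,
    cpair_ins hf h.1, Real.exp_add]
  ring

theorem gibbsWeight_toReal {d : ℕ} {z : ℝ} (hz : 0 ≤ z) {φ : EucSp d → EReal}
    (hφ : IsPairPotential φ) {x : EucSp d} {γ : Config d} (h : Tempered φ x γ) :
    (gibbsWeight z φ (x, γ)).toReal = z * Real.exp (-realEnergy φ x γ) := by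
  simp only [gibbsWeight]
  rw [h.energy_eq hφ, ← EReal.coe_neg, eexp_coe, ENNReal.toReal_mul,
    ENNReal.toReal_ofReal hz, ENNReal.toReal_ofReal (Real.exp_pos _).le]

theorem gibbsWeight_lt_top {d : ℕ} {z : ℝ} {φ : EucSp d → EReal}
    (hφ : IsPairPotential φ) {x : EucSp d} {γ : Config d} (h : Tempered φ x γ) :
    gibbsWeight z φ (x, γ) < ∞ := by
  simp only [gibbsWeight]
  rw [h.energy_eq hφ, ← EReal.coe_neg, eexp_coe]
  exact ENNReal.mul_lt_top ENNReal.ofReal_lt_top ENNReal.ofReal_lt_top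

theorem IsC0.integrable_comp {d : ℕ} {f : EucSp d → ℝ} (hf : IsC0 f) {g : ℝ → ℝ}
    (hg : Continuous g) (h0 : g 0 = 0) : Integrable fun x => g (f x) :=
  (hg.comp hf.1).integrable_of_hasCompactSupport (hf.2.comp_left h0)

theorem ae_prod_fst_ne_snd {d : ℕ} (hd : 0 < d) :
    ∀ᵐ p : EucSp d × EucSp d ∂(volume.prod volume), p.1 ≠ p.2 := by
  have : Nonempty (Fin d) := ⟨⟨0, hd⟩⟩
  refine (Measure.ae_prod_iff_ae_ae (measurableSet_eq_fun measurable_fst measurable_snd).compl).2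
    (Eventually.of_forall fun x => ?_)
  simp [ae_iff]

namespace Setting

variable {d : ℕ} {s z B ξ : ℝ} {φ : EucSp d → EReal} {μ : Measure (Config d)}
  {k u : ∀ n : ℕ, (Fin n → EucSp d) → ℝ}

theorem ae_prod_tempered (h : Setting d s z B ξ φ μ k u) :
    ∀ᵐ p ∂((volume : Measure (EucSp d)).prod μ), Tempered φ p.1 p.2 :=
  have := h.prob
  (Measure.ae_prod_iff_ae_ae (measurableSet_tempered h.pp.meas)).2
    (Eventually.of_forall h.ae_tempered)

theorem ae_prod_tempered_pair (h : Setting d s z B ξ φ μ k u) :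
    ∀ᵐ q ∂(((volume : Measure (EucSp d)).prod (volume : Measure (EucSp d))).prod μ),
      q.1.1 ≠ q.1.2 ∧ Tempered φ q.1.1 q.2 ∧ Tempered φ q.1.2 q.2 := by
  have := h.prob
  have hm : MeasurableSet {q : (EucSp d × EucSp d) × Config d |
      q.1.1 ≠ q.1.2 ∧ Tempered φ q.1.1 q.2 ∧ Tempered φ q.1.2 q.2} := by
    have h1 := measurableSet_tempered h.pp.meas
    refine ((measurableSet_eq_fun (measurable_fst.comp measurable_fst)
      (measurable_snd.comp measurable_fst)).compl).inter (MeasurableSet.inter ?_ ?_)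
    · exact ((measurable_fst.comp measurable_fst).prodMk measurable_snd) h1
    · exact ((measurable_snd.comp measurable_fst).prodMk measurable_snd) h1
  refine (Measure.ae_prod_iff_ae_ae hm).2 ?_
  filter_upwards [ae_prod_fst_ne_snd h.hd] with p hp
  filter_upwards [h.ae_tempered p.1, h.ae_tempered p.2] with γ h1 h2
  exact ⟨hp, h1, h2⟩

theorem weighted_deathTerm_sq (h : Setting d s z B ξ φ μ k u) {f : EucSp d → ℝ} (hf : IsC0 f)
    {x : EucSp d} {γ : Config d} (hx : Tempered φ x γ) :
    (gibbsWeight z φ (x, γ)).toReal *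
        (deathTerm s φ f (γ.ins x, x) * deathTerm s φ f (γ.ins x, x))
      = z * (1 - Real.exp (f x)) ^ 2 * Real.exp (-((1 - 2 * s) * realEnergy φ x γ) +
          -(0 * realEnergy φ x γ) + 2 * cpair f γ) := by
  have he : Real.exp (-((1 - 2 * s) * realEnergy φ x γ) +
      -(0 * realEnergy φ x γ) + 2 * cpair f γ) = Real.exp (-realEnergy φ x γ) *
      (Real.exp (s * realEnergy φ x γ) * Real.exp (s * realEnergy φ x γ)) *
      (Real.exp (cpair f γ) * Real.exp (cpair f γ)) := by
    simp only [← Real.exp_add]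
    congr 1
    ring
  rw [gibbsWeight_toReal h.hz.le h.pp hx, deathTerm_ins h.pp hf.2 hx, he]
  ring

theorem weighted_deathTerm_mul (h : Setting d s z B ξ φ μ k u) {f : EucSp d → ℝ} (hf : IsC0 f)
    {x y : EucSp d} {γ : Config d} (hxy : x ≠ y) (hx : Tempered φ x γ) (hy : Tempered φ y γ) :
    (gibbsWeight₂ z φ ((x, y), γ)).toReal * (deathTerm s φ f ((γ.ins y).ins x, x) *
        deathTerm s φ f ((γ.ins y).ins x, y))
      = z * z * Real.exp (f x) * (1 - Real.exp (f x)) * Real.exp (f y) * (1 - Real.exp (f y)) *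
          rexp (((2 * s - 1 : ℝ) : EReal) * φ (x - y)) *
        Real.exp (-((1 - s) * realEnergy φ x γ) + -((1 - s) * realEnergy φ y γ)
          + 2 * cpair f γ) := by
  obtain ⟨hx', ex⟩ := hx.ins hxy hy.1
  obtain ⟨hy', ey⟩ := hy.ins hxy.symm hx.1
  have hφ : φ (x - y) = ((φ (x - y)).toReal : ℝ) :=
    (EReal.coe_toReal (h.pp.finite_off _ (sub_ne_zero.2 hxy)) (h.pp.ne_bot _)).symm
  have hyx : φ (y - x) = φ (x - y) := by
    rw [← neg_sub]; exact h.pp.even _ (sub_ne_zero.2 hxy)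
  have h1 : (gibbsWeight₂ z φ ((x, y), γ)).toReal
      = z * Real.exp (-realEnergy φ y γ) * (z * Real.exp (-realEnergy φ x (γ.ins y))) := by
    simp only [gibbsWeight₂]
    rw [ENNReal.toReal_mul, gibbsWeight_toReal h.hz.le h.pp hy, gibbsWeight_toReal h.hz.le h.pp hx']
  rw [h1, deathTerm_ins h.pp hf.2 hx', γ.ins_comm x y, deathTerm_ins h.pp hf.2 hy', ex, ey, hyx,
    cpair_ins hf.2 hx.1, cpair_ins hf.2 hy.1, hφ, EReal.toReal_coe, ← EReal.coe_mul, rexp_coe]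
  set t := (φ (x - y)).toReal
  set a := realEnergy φ x γ
  set b := realEnergy φ y γ
  set c := cpair f γ
  have he : Real.exp ((2 * s - 1) * t) *
      Real.exp (-((1 - s) * a) + -((1 - s) * b) + 2 * c) =
      Real.exp (-b) * Real.exp (-(a + t)) * (Real.exp (s * (a + t)) * Real.exp (s * (b + t))) *
        (Real.exp c * Real.exp c) := by
    simp only [← Real.exp_add]
    congr 1
    ring
  rw [mul_assoc _ (Real.exp ((2 * s - 1) * t)), he, Real.exp_add (f x), Real.exp_add (f y)]
  ring

theorem integrable_pair_coeff (h : Setting d s z B ξ φ μ k u) {f : EucSp d → ℝ} (hf : IsC0 f) :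
    Integrable (fun p : EucSp d × EucSp d =>
      z * z * Real.exp (f p.1) * (1 - Real.exp (f p.1)) * Real.exp (f p.2) *
        (1 - Real.exp (f p.2)) * rexp (((2 * s - 1 : ℝ) : EReal) * φ (p.1 - p.2)))
      (volume.prod volume) := by
  have hc : Integrable fun x => Real.exp (f x) * (1 - Real.exp (f x)) :=
    hf.integrable_comp (g := fun t => Real.exp t * (1 - Real.exp t)) (by fun_prop) (by simp)
  have h1 := ((hc.mul_prod hc).const_mul (z * z))
  refine (h1.mul_bdd (c := Real.exp (2 * B))
    (g := fun p => rexp (((2 * s - 1 : ℝ) : EReal) * φ (p.1 - p.2))) ?_ ?_).congr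
      (Eventually.of_forall fun p => ?_)
  · exact (measurable_rexp.comp ((h.pp.meas.comp
      (measurable_fst.sub measurable_snd)).const_mul _)).aestronglyMeasurable
  · filter_upwards [ae_prod_fst_ne_snd h.hd] with p hp
    have hp' := sub_ne_zero.2 hp
    rw [Real.norm_of_nonneg (rexp_nonneg _), ← EReal.coe_toReal (h.pp.finite_off _ hp')
      (h.pp.ne_bot _), ← EReal.coe_mul, rexp_coe]
    have := exp_neg_mul_le (c := 1 - 2 * s) h.hB (by linarith [h.hs1]) (by linarith [h.hs0])
      (h.stable.neg_le_toReal h.pp hp')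
    rwa [← neg_mul, neg_sub] at this
  · simp only; ring

end Setting

end

/-- explicit formula for `∫_Γ (H_0^- F)² dμ` with `F = e^{⟨f,·⟩}`. -/
theorem statement13 (d : ℕ) (s z B ξ : ℝ) (φ : EucSp d → EReal) (μ : Measure (Config d))
    (k u : ∀ n : ℕ, (Fin n → EucSp d) → ℝ) (hset : Setting d s z B ξ φ μ k u)
    (f : EucSp d → ℝ) (hf : IsC0 f) :
    ∫ γ, (H0Minus s φ (fun γ' => Real.exp (cpair f γ')) γ) ^ 2 ∂μ
      = (∫ x : EucSp d, z * (1 - Real.exp (f x)) ^ 2 *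
            ∫ γ, rexp (((2 * s - 1 : ℝ) : EReal) * energy φ x γ.1 +
              ((2 * cpair f γ : ℝ) : EReal)) ∂μ)
        + ∫ x₁ : EucSp d, ∫ x₂ : EucSp d,
            z * z * Real.exp (f x₁) * (1 - Real.exp (f x₁)) *
              Real.exp (f x₂) * (1 - Real.exp (f x₂)) *
              rexp (((2 * s - 1 : ℝ) : EReal) * φ (x₁ - x₂)) *
            ∫ γ, rexp (((s - 1 : ℝ) : EReal) * energy φ x₁ γ.1 +
              ((s - 1 : ℝ) : EReal) * energy φ x₂ γ.1 +
              ((2 * cpair f γ : ℝ) : EReal)) ∂μ := by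
  have := hset.prob
  obtain ⟨C, hC⟩ := hset.exists_lintegral_exp_le hf
  have hs0 := hset.hs0
  have hs1 := hset.hs1
  have hD := measurable_deathTerm (s := s) hset.pp.meas hf.1.measurable
  let G : Config d × (EucSp d × EucSp d) → ℝ := fun q =>
    deathTerm s φ f (q.1, q.2.1) * deathTerm s φ f (q.1, q.2.2)
  have hG : Measurable G :=
    (hD.comp (measurable_fst.prodMk (measurable_fst.comp measurable_snd))).mul
      (hD.comp (measurable_fst.prodMk (measurable_snd.comp measurable_snd)))
  have hx : Measurable fun q : (EucSp d × EucSp d) × Config d => (q.1.2, q.2) :=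
    (measurable_snd.comp measurable_fst).prodMk measurable_snd
  have hT₁ : Measurable fun p : EucSp d × Config d =>
      (gibbsWeight z φ p).toReal * G (p.2.ins p.1, (p.1, p.1)) :=
    (measurable_gibbsWeight hset.pp.meas).ennreal_toReal.mul
      (hG.comp (Config.measurable_ins.prodMk (measurable_fst.prodMk measurable_fst)))
  have hT₂ : Measurable fun q : (EucSp d × EucSp d) × Config d =>
      (gibbsWeight₂ z φ q).toReal * G ((q.2.ins q.1.2).ins q.1.1, q.1) :=
    (measurable_gibbsWeight₂ hset.pp.meas).ennreal_toReal.mul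
      (hG.comp ((Config.measurable_ins.comp ((measurable_fst.comp measurable_fst).prodMk
        (Config.measurable_ins.comp hx))).prodMk measurable_fst))
  obtain ⟨hI₁, -, hE₁⟩ := integral_prod_of_lintegral_le (ν := volume) (μ := μ)
    hT₁.aestronglyMeasurable
    (hf.integrable_comp (g := fun t => z * (1 - Real.exp t) ^ 2) (by fun_prop) (by simp))
    (e := fun x γ => Real.exp (-((1 - 2 * s) * realEnergy φ x γ) + -(0 * realEnergy φ x γ)
      + 2 * cpair f γ))
    (by filter_upwards [hset.ae_prod_tempered] with p hp using hset.weighted_deathTerm_sq hf hp)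
    (fun _ _ => (Real.exp_pos _).le)
    fun x => hC (1 - 2 * s) 0 (by linarith) (by linarith) le_rfl zero_le_one x x
  obtain ⟨hI₂, hJ₂, hE₂⟩ := integral_prod_of_lintegral_le (ν := volume.prod volume) (μ := μ)
    hT₂.aestronglyMeasurable (hset.integrable_pair_coeff hf)
    (e := fun p γ => Real.exp (-((1 - s) * realEnergy φ p.1 γ) + -((1 - s) * realEnergy φ p.2 γ)
      + 2 * cpair f γ))
    (by
      filter_upwards [hset.ae_prod_tempered_pair] with q hq using
        hset.weighted_deathTerm_mul hf hq.1 hq.2.1 hq.2.2)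
    (fun _ _ => (Real.exp_pos _).le)
    fun p => hC (1 - s) (1 - s) (by linarith) (by linarith) (by linarith) (by linarith) p.1 p.2
  have hfin₁ : ∀ᵐ p ∂((volume : Measure (EucSp d)).prod μ), gibbsWeight z φ p < ∞ := by
    filter_upwards [hset.ae_prod_tempered] with p hp using gibbsWeight_lt_top hset.pp hp
  have hfin₂ : ∀ᵐ q ∂(((volume : Measure (EucSp d)).prod (volume : Measure (EucSp d))).prod μ),
      gibbsWeight₂ z φ q < ∞ := by
    filter_upwards [hset.ae_prod_tempered_pair] with q hq using
      ENNReal.mul_lt_top (gibbsWeight_lt_top hset.pp hq.2.2)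
        (gibbsWeight_lt_top hset.pp (hq.2.1.ins hq.1 hq.2.2.1).1)
  simp only [H0Minus_sq]
  rw [hset.gnz.integral_pair hset.pp.meas hset.ae_notMem hG hfin₁ hfin₂ hI₁ hI₂, hE₁, hE₂,
    integral_prod _ hJ₂]
  congr 1
  · refine integral_congr_ae (Eventually.of_forall fun x => ?_)
    simp only
    congr 1
    refine integral_congr_ae ?_
    filter_upwards [hset.ae_tempered x] with γ hγ
    rw [hγ.energy_eq hset.pp, ← EReal.coe_mul, ← EReal.coe_add, rexp_coe]
    congr 1
    ring
  · refine integral_congr_ae (Eventually.of_forall fun x₁ => ?_)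
    refine integral_congr_ae (Eventually.of_forall fun x₂ => ?_)
    simp only
    congr 1
    refine integral_congr_ae ?_
    filter_upwards [hset.ae_tempered x₁, hset.ae_tempered x₂] with γ h₁ h₂
    rw [h₁.energy_eq hset.pp, h₂.energy_eq hset.pp, ← EReal.coe_mul, ← EReal.coe_mul,
      ← EReal.coe_add, ← EReal.coe_add, rexp_coe]
    congr 1
    ring

end
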